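/- Let p be an odd prime and fix natural numbers d₁, d₂. For each nonzero integer i with −d₂ ≤ i ≤ d₁, fix a closed ball B_i = { x ∈ ℤ_p : ‖x − c_i‖ ≤ p^{−r_i} } with center c_i ∈ ℤ_p and radius exponent r_i ∈ ℕ. For each n, let GL_n(ℤ_p) be the (compact) group of units of the n×n matrix ring over ℤ_p and μ_n its Haar probability measure, and let ν be the Haar probability measure on the compact additive group ℤ_p. Then, as n → ∞, μ_n { M ∈ GL_n(ℤ_p) : for every nonzero i with −d₂ ≤ i ≤ d₁, trace(M^i) − [p ∣ i] · trace(M^{i/p}) ∈ B_i } converges to the product over these i of ν { x ∈ ℤ_p : p^{v_p(i)} · x ∈ B_i }. -/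

import Mathlib

open MeasureTheory Filter

noncomputable instance (p : ℕ) [Fact p.Prime] : MeasurableSpace ℤ_[p] := borel _
instance (p : ℕ) [Fact p.Prime] : BorelSpace ℤ_[p] := ⟨rfl⟩
noncomputable instance (p n : ℕ) [Fact p.Prime] :
    MeasurableSpace (Matrix (Fin n) (Fin n) ℤ_[p])ˣ := borel _
instance (p n : ℕ) [Fact p.Prime] :
    BorelSpace (Matrix (Fin n) (Fin n) ℤ_[p])ˣ := ⟨rfl⟩

section Triangular

/-- A self-map of `R^d` that is triangular with units on the diagonal is bijective. -/
theorem bijective_of_triangular {R : Type*} [CommRing R] [Finite R] {d : ℕ}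
    (f : (Fin d → R) → Fin d → R) (u : Fin d → R) (hu : ∀ i, IsUnit (u i))
    (hf : ∀ i x y, (∀ j < i, x j = y j) → f x i - u i * x i = f y i - u i * y i) :
    Function.Bijective f := by
  refine Finite.injective_iff_bijective.1 fun x y hxy => ?_
  have key : ∀ i, x i = y i := by
    intro i
    induction i using WellFoundedLT.induction with
    | ind i ih =>
      have h := hf i x y ih
      rw [hxy] at h
      exact (hu i).mul_left_cancel (by simpa using h)
  exact funext key

end Triangular

section LogDeriv

open PowerSeries

variable {R : Type*} [CommRing R]

/-- `T` is minus the logarithmic derivative of `f` multiplied by `X`. -/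
def IsNegLogDeriv (f T : R⟦X⟧) : Prop := -(X * derivative R f) = f * T

theorem IsNegLogDeriv.one : IsNegLogDeriv (1 : R⟦X⟧) 0 := by
  simp [IsNegLogDeriv]

theorem IsNegLogDeriv.mul {f g T S : R⟦X⟧} (hf : IsNegLogDeriv f T) (hg : IsNegLogDeriv g S) :
    IsNegLogDeriv (f * g) (T + S) := by
  unfold IsNegLogDeriv at *
  rw [Derivation.leibniz]
  simp only [smul_eq_mul]
  linear_combination g * hf + f * hg

theorem IsNegLogDeriv.prod {ι : Type*} (s : Finset ι) {f T : ι → R⟦X⟧}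
    (h : ∀ i ∈ s, IsNegLogDeriv (f i) (T i)) :
    IsNegLogDeriv (∏ i ∈ s, f i) (∑ i ∈ s, T i) := by
  classical
  induction s using Finset.induction_on with
  | empty => simpa using IsNegLogDeriv.one
  | insert a s ha ih =>
    rw [Finset.prod_insert ha, Finset.sum_insert ha]
    exact (h a (by simp)).mul (ih fun i hi => h i (by simp [hi]))

theorem isNegLogDeriv_one_sub (j : ℕ) (hj : j ≠ 0) (y : R) :
    IsNegLogDeriv (1 - C y * X ^ j)
      (PowerSeries.mk fun i => if j ∣ i ∧ i ≠ 0 then (j : R) * y ^ (i / j) else 0) := by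
  set T := PowerSeries.mk fun i => if j ∣ i ∧ i ≠ 0 then (j : R) * y ^ (i / j) else 0 with hT
  have h1 : X * derivative R (1 - C y * X ^ j) = -(C (j * y) * X ^ j) := by
    obtain ⟨k, rfl⟩ := Nat.exists_eq_succ_of_ne_zero hj
    rw [map_sub, Derivation.leibniz, derivative_C, derivative_pow, derivative_X, derivative_one]
    simp only [Nat.succ_eq_add_one, add_tsub_cancel_right, smul_eq_mul, map_mul, map_natCast]
    ring
  have h2 : T = C (j * y) * X ^ j + C y * (X ^ j * T) := by
    ext i
    rw [map_add, coeff_C_mul, coeff_C_mul, coeff_X_pow, coeff_X_pow_mul', hT, coeff_mk, coeff_mk]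
    by_cases hij : j ≤ i
    · obtain ⟨a, rfl⟩ := Nat.exists_eq_add_of_le hij
      have hj0 : 0 < j := Nat.pos_of_ne_zero hj
      rcases Nat.eq_zero_or_pos a with rfl | ha
      · simp [hj, hj0]
      · have h3 : j + a ≠ j := by omega
        have h4 : j + a ≠ 0 := by omega
        simp only [Nat.dvd_add_right (dvd_refl j), if_pos hij, Nat.add_sub_cancel_left, h3,
          if_false, mul_zero, zero_add, Nat.add_div_left a hj0, ha.ne', ne_eq, not_false_eq_true,
          and_true, h4]
        split_ifs
        · rw [pow_succ]; ring
        · simp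
    · have : ¬ (j ∣ i ∧ i ≠ 0) := fun h => hij (Nat.le_of_dvd (Nat.pos_of_ne_zero h.2) h.1)
      rw [if_neg this, if_neg hij, if_neg (by omega)]
      simp
  unfold IsNegLogDeriv
  rw [h1]
  linear_combination -h2

/-- The coefficients of the negative logarithmic derivative are determined by those of `f`. -/
theorem IsNegLogDeriv.coeff_congr {f g T S : R⟦X⟧} (hf : IsNegLogDeriv f T)
    (hg : IsNegLogDeriv g S) (hf0 : coeff 0 f = 1) {d : ℕ}
    (hfg : ∀ i ≤ d, coeff i f = coeff i g) : ∀ i ≤ d, coeff i T = coeff i S := by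
  intro i
  induction i using Nat.strong_induction_on with
  | _ i ih =>
    intro hi
    have hl : coeff i (X * derivative R f) = coeff i (X * derivative R g) := by
      cases i with
      | zero => simp
      | succ k => rw [coeff_succ_X_mul, coeff_succ_X_mul, coeff_derivative, coeff_derivative, hfg _ hi]
    have h1 := congrArg (coeff i) hf
    have h2 := congrArg (coeff i) hg
    rw [map_neg, hl, ← map_neg, h2, coeff_mul, coeff_mul] at h1
    rw [← Finset.add_sum_erase _ _ (show (0, i) ∈ Finset.HasAntidiagonal.antidiagonal i by simp),
      ← Finset.add_sum_erase (Finset.HasAntidiagonal.antidiagonal i) (fun x => coeff x.1 f * coeff x.2 T)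
      (show (0, i) ∈ Finset.HasAntidiagonal.antidiagonal i by simp)] at h1
    have h3 : ∑ x ∈ (Finset.HasAntidiagonal.antidiagonal i).erase (0, i), coeff x.1 g * coeff x.2 S =
        ∑ x ∈ (Finset.HasAntidiagonal.antidiagonal i).erase (0, i), coeff x.1 f * coeff x.2 T := by
      refine Finset.sum_congr rfl fun x hx => ?_
      simp only [Finset.mem_erase, Finset.HasAntidiagonal.mem_antidiagonal, ne_eq,
        Prod.ext_iff, not_and] at hx
      rw [hfg x.1 (by omega), ih x.2 (by omega) (by omega)]
    rw [h3] at h1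
    have h4 := add_right_cancel h1
    simp only [← hfg 0 (Nat.zero_le _), hf0, one_mul] at h4
    exact h4.symm

theorem PowerSeries.derivative_finset_prod {ι : Type*} [DecidableEq ι] (s : Finset ι)
    (f : ι → R⟦X⟧) :
    derivative R (∏ i ∈ s, f i) = ∑ i ∈ s, (∏ k ∈ s.erase i, f k) * derivative R (f i) := by
  induction s using Finset.induction_on with
  | empty => simp
  | insert a s ha ih =>
    rw [Finset.prod_insert ha, Derivation.leibniz, ih, Finset.sum_insert ha,
      Finset.erase_insert ha, smul_eq_mul, smul_eq_mul, Finset.mul_sum, add_comm]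
    refine congrArg₂ (· + ·) rfl (Finset.sum_congr rfl fun i hi => ?_)
    have hia : a ≠ i := fun h => ha (h ▸ hi)
    rw [Finset.erase_insert_of_ne hia, Finset.prod_insert (by simp [ha]), mul_assoc]

/-- The Jacobi formula for the derivative of a determinant. -/
theorem PowerSeries.derivative_det {n : Type*} [Fintype n] [DecidableEq n]
    (A : Matrix n n R⟦X⟧) :
    derivative R A.det = (A.adjugate * A.map (derivative R)).trace := by
  have h : ∀ i, (A.adjugate * A.map (derivative R)) i i =
      (A.updateCol i fun j => derivative R (A j i)).det := by
    intro i
    rw [← Matrix.cramer_apply, Matrix.cramer_eq_adjugate_mulVec]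
    rfl
  simp only [Matrix.trace, Matrix.diag_apply, h, Matrix.det_apply', map_sum]
  rw [Finset.sum_comm]
  refine Finset.sum_congr rfl fun σ _ => ?_
  have h0 : derivative R (((Equiv.Perm.sign σ : ℤ) : R⟦X⟧)) = 0 := Derivation.map_intCast _ _
  rw [← Finset.mul_sum, Derivation.leibniz, h0, smul_zero, add_zero, smul_eq_mul,
    derivative_finset_prod]
  congr 1
  refine Finset.sum_congr rfl fun i (_ : i ∈ Finset.univ) => ?_
  rw [← Finset.mul_prod_erase _ _ (Finset.mem_univ i), mul_comm]
  congr 1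
  · simp
  · refine Finset.prod_congr rfl fun k hk => ?_
    rw [Matrix.updateCol_ne (Finset.ne_of_mem_erase hk)]

theorem isNegLogDeriv_charpolyRev {n : Type*} [Fintype n] [DecidableEq n] (M : Matrix n n R) :
    IsNegLogDeriv (M.charpolyRev : R⟦X⟧)
      (PowerSeries.mk fun i => if i = 0 then 0 else (M ^ i).trace) := by
  let A : Matrix n n R⟦X⟧ := 1 - (X : R⟦X⟧) • M.map C
  let G : Matrix n n R⟦X⟧ := Matrix.of fun a b => PowerSeries.mk fun i => (M ^ i) a b
  have hA : (M.charpolyRev : R⟦X⟧) = A.det := by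
    rw [Matrix.charpolyRev, ← Polynomial.coeToPowerSeries.ringHom_apply, RingHom.map_det]
    congr 1
    ext a b : 2
    by_cases hab : a = b <;> simp [A, hab] <;> ring
  have hAG : A * G = 1 := by
    ext a b i
    have : (A * G) a b = G a b - X * ∑ c, C (M a c) * G c b := by
      simp only [A, sub_mul, one_mul, Matrix.smul_mul, Matrix.sub_apply, Matrix.smul_apply,
        smul_eq_mul]
      simp [Matrix.mul_apply]
    rw [this, map_sub]
    cases i with
    | zero =>
      by_cases hab : a = b <;> simp [G, Matrix.one_apply, hab]
    | succ i =>
      rw [coeff_succ_X_mul, map_sum]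
      by_cases hab : a = b <;>
        simp [G, Matrix.one_apply, hab, pow_succ', Matrix.mul_apply, coeff_one]
  have hd : A.map (derivative R) = -M.map C := by
    ext a b : 2
    by_cases hab : a = b <;> simp [A, hab]
  have hadj : A.adjugate = A.det • G := by
    calc A.adjugate = A.adjugate * (A * G) := by rw [hAG, mul_one]
      _ = _ := by rw [← mul_assoc, Matrix.adjugate_mul, smul_mul_assoc, one_mul]
  have hT : X * (G * M.map C).trace =
      PowerSeries.mk fun i => if i = 0 then 0 else (M ^ i).trace := by
    ext i
    cases i with
    | zero => simp
    | succ i =>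
      rw [coeff_succ_X_mul]
      simp [G, Matrix.trace, Matrix.mul_apply, pow_succ, coeff_mul_C]
  unfold IsNegLogDeriv
  rw [hA, PowerSeries.derivative_det, hd, hadj, ← hT, mul_neg, Matrix.trace_neg, smul_mul_assoc,
    Matrix.trace_smul, smul_eq_mul]
  ring

end LogDeriv

section Ghost

open PowerSeries

variable {R : Type*} [CommRing R]

theorem exists_ghost_term (p : ℕ) [hp : Fact p.Prime] (hF : ∀ z : R, (p : R) ∣ z ^ p - z)
    {i j : ℕ} (hi : i ≠ 0) (hj : j ∣ i) (z : R) :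
    ∃ w : R, (j : R) * (z ^ (i / j) - if p ∣ i / j then z ^ (i / j / p) else 0) =
      (p : R) ^ padicValNat p i * w ∧
      (j = i → w = ((i / p ^ padicValNat p i : ℕ) : R) * z) := by
  obtain ⟨q, rfl⟩ := hj
  have hj0 : j ≠ 0 := left_ne_zero_of_mul hi
  have hq0 : q ≠ 0 := right_ne_zero_of_mul hi
  rw [Nat.mul_div_cancel_left _ (Nat.pos_of_ne_zero hj0)]
  have hjv : j = p ^ padicValNat p j * (j / p ^ padicValNat p j) :=
    (Nat.mul_div_cancel' pow_padicValNat_dvd).symm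
  by_cases hq1 : q = 1
  · subst hq1
    rw [mul_one]
    refine ⟨_, ?_, fun _ => rfl⟩
    rw [if_neg (fun h => hp.out.one_lt.ne' (Nat.dvd_one.1 h)), sub_zero, pow_one, ← mul_assoc]
    congr 1
    exact_mod_cast congrArg (Nat.cast (R := R)) hjv
  · rw [padicValNat.mul hj0 hq0]
    have hne : j ≠ j * q := fun h => hq1 (by
      simpa using (Nat.mul_left_cancel (Nat.pos_of_ne_zero hj0) ((mul_one j).trans h)).symm)
    have hdvd : (p : R) ^ padicValNat p q ∣ z ^ q - if p ∣ q then z ^ (q / p) else 0 := by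
      split_ifs with hpq
      · obtain ⟨a, ha⟩ : ∃ a, padicValNat p q = a + 1 :=
          Nat.exists_eq_succ_of_ne_zero (dvd_iff_padicValNat_ne_zero hq0 |>.1 hpq)
        obtain ⟨m, hm⟩ : p ^ (a + 1) ∣ q := ha ▸ pow_padicValNat_dvd
        have h1 : q / p = m * p ^ a := by
          rw [hm, pow_succ]
          exact Nat.div_eq_of_eq_mul_left hp.out.pos (by ring)
        rw [h1, ha, hm]
        have := dvd_sub_pow_of_dvd_sub (hF (z ^ m)) a
        convert this using 1
        rw [← pow_mul, ← pow_mul, ← pow_mul]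
        congr 2
        ring
      · rw [padicValNat.eq_zero_of_not_dvd hpq]
        simp
    obtain ⟨w, hw⟩ := hdvd
    refine ⟨((j / p ^ padicValNat p j : ℕ) : R) * w, ?_, fun h => absurd h hne⟩
    rw [hw]
    have : (j : R) = (p : R) ^ padicValNat p j * ((j / p ^ padicValNat p j : ℕ) : R) := by
      exact_mod_cast congrArg (Nat.cast (R := R)) hjv
    rw [pow_add]
    linear_combination ((p : R) ^ padicValNat p q * w) * this

theorem X_pow_dvd_prod_one_sub_sub_one {ι : Type*} (s : Finset ι) (e : ι → ℕ) (y : ι → R) (k : ℕ)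
    (h : ∀ j ∈ s, k ≤ e j) : (X : R⟦X⟧) ^ k ∣ ∏ j ∈ s, (1 - C (y j) * X ^ e j) - 1 := by
  classical
  induction s using Finset.induction_on with
  | empty => simp
  | insert a s ha ih =>
    rw [Finset.prod_insert ha]
    have h1 := ih fun j hj => h j (by simp [hj])
    have h2 : (X : R⟦X⟧) ^ k ∣ X ^ e a := pow_dvd_pow _ (h a (by simp))
    have : (1 - C (y a) * X ^ e a) * ∏ j ∈ s, (1 - C (y j) * X ^ e j) - 1 =
      (∏ j ∈ s, (1 - C (y j) * X ^ e j) - 1) -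
        X ^ e a * (C (y a) * ∏ j ∈ s, (1 - C (y j) * X ^ e j)) := by ring
    rw [this]
    exact dvd_sub h1 (h2.mul_right _)

/-- The coefficients of `∏ (1 - y_j X^j)`, for `1 ≤ j ≤ d`, parametrise the truncated power series
with constant coefficient `1`. -/
theorem bijective_coeff_prod_one_sub [Finite R] (d : ℕ) :
    Function.Bijective fun (y : Fin d → R) (i : Fin d) =>
      coeff (i + 1 : ℕ) (∏ j : Fin d, (1 - C (y j) * (X : R⟦X⟧) ^ (j + 1 : ℕ))) := by
  refine bijective_of_triangular _ (fun _ => -1) (fun _ => isUnit_one.neg) fun i => ?_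
  have key : ∀ x : Fin d → R,
      coeff (i + 1 : ℕ) (∏ j : Fin d, (1 - C (x j) * (X : R⟦X⟧) ^ (j + 1 : ℕ))) - -1 * x i =
      coeff (i + 1 : ℕ) (∏ j ∈ Finset.univ.filter (· < i),
        (1 - C (x j) * (X : R⟦X⟧) ^ (j + 1 : ℕ))) := by
    intro x
    set P := ∏ j ∈ Finset.univ.filter (· < i), (1 - C (x j) * (X : R⟦X⟧) ^ (j + 1 : ℕ)) with hP
    obtain ⟨Q, hQ⟩ := X_pow_dvd_prod_one_sub_sub_one (Finset.univ.filter (i < ·))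
      (fun j : Fin d => (j + 1 : ℕ)) x (i + 2) (fun j hj => by
        simp only [Finset.mem_filter, Finset.mem_univ, true_and, Fin.lt_def] at hj
        omega)
    have hP1 : coeff 0 P = 1 := by
      simp [hP, map_prod]
    have hsplit : (∏ j : Fin d, (1 - C (x j) * (X : R⟦X⟧) ^ (j + 1 : ℕ))) =
        P * ((1 - C (x i) * X ^ (i + 1 : ℕ)) * (1 + X ^ (i + 2 : ℕ) * Q)) := by
      rw [← hQ, add_sub_cancel, ← Finset.prod_filter_mul_prod_filter_not Finset.univ (· < i)]
      congr 1
      have : Finset.univ.filter (fun j => ¬ j < i) =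
          insert i (Finset.univ.filter (i < ·)) := by
        ext j
        simp [le_iff_eq_or_lt, eq_comm]
      rw [this, Finset.prod_insert (by simp)]
    have : P * ((1 - C (x i) * X ^ (i + 1 : ℕ)) * (1 + X ^ (i + 2 : ℕ) * Q)) =
        P - C (x i) * (X ^ (i + 1 : ℕ) * P) +
          X ^ (i + 2 : ℕ) * (P * (1 - C (x i) * X ^ (i + 1 : ℕ)) * Q) := by ring
    rw [hsplit, this, map_add, map_sub, coeff_C_mul, coeff_X_pow_mul', coeff_X_pow_mul',
      if_pos le_rfl, if_neg (by omega), Nat.sub_self, hP1]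
    ring
  intro x y hxy
  simp only [key]
  congr 1
  refine Finset.prod_congr rfl fun j hj => ?_
  rw [hxy j (by simpa using hj)]

/-- The differences `S_i - [p ∣ i] S_{i/p}` of the coefficients of a negative logarithmic
derivative are `p^{v_p(i)}` times coordinates that depend bijectively on the coefficients of the
original power series. -/
theorem exists_bijective_ghost [Finite R] (p : ℕ) [hp : Fact p.Prime]
    (hF : ∀ z : R, (p : R) ∣ z ^ p - z) (hU : ∀ m : ℕ, ¬ p ∣ m → IsUnit (m : R)) (d : ℕ) :
    ∃ T : (Fin d → R) → Fin d → R, Function.Bijective T ∧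
      ∀ f S : R⟦X⟧, IsNegLogDeriv f S → coeff 0 f = 1 → ∀ i : Fin d,
        coeff (i + 1 : ℕ) S - (if p ∣ i + 1 then coeff ((i + 1) / p : ℕ) S else 0) =
          (p : R) ^ padicValNat p (i + 1) * T (fun j => coeff (j + 1 : ℕ) f) i := by
  have hθ : ∀ i j : ℕ, ∀ z : R, ∃ w : R, i ≠ 0 → j ∣ i →
      (j : R) * (z ^ (i / j) - if p ∣ i / j then z ^ (i / j / p) else 0) =
      (p : R) ^ padicValNat p i * w ∧
      (j = i → w = ((i / p ^ padicValNat p i : ℕ) : R) * z) := by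
    intro i j z
    by_cases h : i ≠ 0 ∧ j ∣ i
    · obtain ⟨w, hw⟩ := exists_ghost_term p hF h.1 h.2 z
      exact ⟨w, fun _ _ => hw⟩
    · exact ⟨0, fun h1 h2 => absurd ⟨h1, h2⟩ h⟩
  choose θ hθ using hθ
  let U : (Fin d → R) → Fin d → R := fun y i =>
    ∑ j : Fin d, if (j + 1 : ℕ) ∣ i + 1 then θ (i + 1) (j + 1) (y j) else 0
  have hUb : Function.Bijective U := by
    refine bijective_of_triangular U
      (fun i => (((i + 1 : ℕ) / p ^ padicValNat p (i + 1) : ℕ) : R))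
      (fun i => hU _ ?_) fun i x y hxy => ?_
    · exact Nat.not_dvd_ordCompl hp.out (Nat.succ_ne_zero _) |> fun h => by
        rwa [Nat.factorization_def _ hp.out] at h
    · have key : ∀ x : Fin d → R,
          U x i - (((i + 1 : ℕ) / p ^ padicValNat p (i + 1) : ℕ) : R) * x i =
          ∑ j ∈ Finset.univ.erase i,
            if (j + 1 : ℕ) ∣ i + 1 then θ (i + 1) (j + 1) (x j) else 0 := by
        intro x
        rw [sub_eq_iff_eq_add', ← (hθ (i + 1) (i + 1) (x i) (by omega) dvd_rfl).2 rfl]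
        simp only [U]
        rw [← Finset.add_sum_erase _ _ (Finset.mem_univ i), if_pos dvd_rfl]
      rw [key, key]
      refine Finset.sum_congr rfl fun j hj => ?_
      split_ifs with hd
      · have := Nat.le_of_dvd (Nat.succ_pos _) hd
        rw [hxy j (lt_of_le_of_ne (Fin.le_def.2 (by omega)) (Finset.ne_of_mem_erase hj))]
      · rfl
  let W := Equiv.ofBijective _ (bijective_coeff_prod_one_sub (R := R) d)
  refine ⟨U ∘ W.symm, hUb.comp W.symm.bijective, fun f S hfS hf0 i => ?_⟩
  set y := W.symm fun j : Fin d => coeff (j + 1 : ℕ) f with hy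
  have hWy : ∀ j : Fin d, coeff (j + 1 : ℕ) (∏ j : Fin d, (1 - C (y j) * (X : R⟦X⟧) ^ (j + 1 : ℕ)))
      = coeff (j + 1 : ℕ) f := by
    intro j
    exact congrFun (W.apply_symm_apply fun j : Fin d => coeff (j + 1 : ℕ) f) j
  have hlog := IsNegLogDeriv.prod (Finset.univ : Finset (Fin d))
    fun j _ => isNegLogDeriv_one_sub (j + 1 : ℕ) (Nat.succ_ne_zero _) (y j)
  have hS : ∀ k ≤ d, coeff k S = ∑ j : Fin d,
      if (j + 1 : ℕ) ∣ k ∧ k ≠ 0 then ((j + 1 : ℕ) : R) * y j ^ (k / (j + 1)) else 0 := by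
    intro k hk
    rw [hfS.coeff_congr hlog hf0 (d := d) _ k hk, map_sum]
    · simp only [coeff_mk]
    · intro k hk
      cases k with
      | zero => rw [hf0]; simp [map_prod]
      | succ k => exact (hWy ⟨k, hk⟩).symm
  have hi1 : (i + 1 : ℕ) ≤ d := i.2
  rw [hS _ hi1, hS _ ((Nat.div_le_self _ _).trans hi1)]
  simp only [Function.comp_apply, ← hy, U]
  rw [Finset.mul_sum]
  have : ∀ (P : Prop) [Decidable P] (g : Fin d → R),
      (if P then ∑ j, g j else 0) = ∑ j, if P then g j else 0 := by
    intro P _ g; split_ifs <;> simp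
  rw [this, ← Finset.sum_sub_distrib]
  refine Finset.sum_congr rfl fun j _ => ?_
  by_cases hji : (j + 1 : ℕ) ∣ i + 1
  · rw [if_pos ⟨hji, Nat.succ_ne_zero _⟩, if_pos hji, ← (hθ _ _ _ (Nat.succ_ne_zero _) hji).1]
    obtain ⟨q, hq⟩ := hji
    have hq' : (i + 1 : ℕ) / (j + 1) = q := by rw [hq]; exact Nat.mul_div_cancel_left _ (by omega)
    rw [hq', mul_sub]
    congr 1
    by_cases hpq : p ∣ q
    · obtain ⟨a, rfl⟩ := hpq
      have h1 : (i + 1 : ℕ) = p * ((j + 1) * a) := by rw [hq]; ring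
      have ha0 : a ≠ 0 := by rintro rfl; simp at h1
      rw [h1, Nat.mul_div_cancel_left _ hp.out.pos, Nat.mul_div_cancel_left _ hp.out.pos,
        if_pos (dvd_mul_right _ _), if_pos (dvd_mul_right _ _),
        if_pos ⟨dvd_mul_right _ _, by positivity⟩, Nat.mul_div_cancel_left _ (by omega)]
    · rw [if_neg hpq, mul_zero]
      split_ifs with h1 h2
      · exfalso
        apply hpq
        obtain ⟨b, hb⟩ := h2.1
        obtain ⟨c, hc⟩ := h1
        rw [hc, Nat.mul_div_cancel_left _ hp.out.pos] at hb
        refine ⟨b, Nat.mul_left_cancel (Nat.succ_pos j) ?_⟩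
        rw [Nat.succ_eq_add_one, ← hq, hc, hb]; ring
      · rfl
      · rfl
  · rw [if_neg (fun h => hji h.1), if_neg hji, mul_zero]
    split_ifs with h1 h2
    · exact absurd (h2.1.trans (Nat.div_dvd_of_dvd h1)) hji
    · simp
    · simp

end Ghost

section Shift

open Polynomial Matrix

variable {R : Type*} [CommRing R] {N : ℕ}

/-- The first `m` columns of `M` are the basis vectors `e₁, …, e_m` (counting from zero). -/
def IsShift (m : ℕ) (M : Matrix (Fin (N + 1)) (Fin (N + 1)) R) : Prop :=
  ∀ a r : Fin (N + 1), (a : ℕ) < m → M r a = if (r : ℕ) = a + 1 then 1 else 0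

/-- The additive group of matrices supported in the block of rows `< m` and columns `≥ m`. -/
def cornerBlock (R : Type*) [CommRing R] (N m : ℕ) :
    AddSubgroup (Matrix (Fin (N + 1)) (Fin (N + 1)) R) where
  carrier := {B | ∀ j k : Fin (N + 1), ¬ ((j : ℕ) < m ∧ m ≤ k) → B j k = 0}
  add_mem' ha hb j k h := by simp [ha j k h, hb j k h]
  zero_mem' _ _ _ := rfl
  neg_mem' ha j k h := by simp [ha j k h]

theorem cornerBlock_mul {m : ℕ} {B B' : Matrix (Fin (N + 1)) (Fin (N + 1)) R}
    (hB : B ∈ cornerBlock R N m) (hB' : B' ∈ cornerBlock R N m) : B * B' = 0 := by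
  ext i k
  rw [Matrix.mul_apply]
  refine Finset.sum_eq_zero fun j _ => ?_
  by_cases hj : (j : ℕ) < m
  · rw [hB i j (by omega), zero_mul]
  · rw [hB' j k (by omega), mul_zero]

/-- The polynomial `∑ B_{jk} X^{j+1} Q_k`. -/
noncomputable def cornerPoly (Q : Fin (N + 1) → R[X]) :
    Matrix (Fin (N + 1)) (Fin (N + 1)) R →+ R[X] where
  toFun B := ∑ k, (∑ j : Fin (N + 1), X ^ (j + 1 : ℕ) * C (B j k)) * Q k
  map_zero' := by simp
  map_add' B B' := by
    simp [mul_add, add_mul, Finset.sum_add_distrib]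

theorem cornerPoly_single (Q : Fin (N + 1) → R[X]) (j k : Fin (N + 1)) (x : R) :
    cornerPoly Q (Matrix.single j k x) = X ^ (j + 1 : ℕ) * C x * Q k := by
  change ∑ k', (∑ j' : Fin (N + 1), X ^ (j' + 1 : ℕ) * C (Matrix.single j k x j' k')) * Q k' = _
  rw [Finset.sum_eq_single k, Finset.sum_eq_single j]
  · simp
  · intro j' _ h; simp [h.symm]
  · simp
  · intro k' _ h
    rw [Finset.sum_eq_zero, zero_mul]
    intro j' _
    simp [h.symm]
  · simp

theorem det_updateRow_sub_eq {n S : Type*} [Fintype n] [DecidableEq n] [CommRing S]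
    (A : Matrix n n S) (i : n) (b : n → S) :
    (A.updateRow i (A i - b)).det = A.det - ∑ k, b k * A.adjugate k i := by
  rw [← Matrix.cramer_transpose_apply, map_sub, Pi.sub_apply, Matrix.cramer_transpose_apply,
    Matrix.updateRow_eq_self, Matrix.cramer_eq_adjugate_mulVec, ← Matrix.adjugate_transpose]
  simp [Matrix.mulVec, dotProduct, mul_comm]

theorem charpoly_mul_one_add {m : ℕ} {M B : Matrix (Fin (N + 1)) (Fin (N + 1)) R}
    (hM : IsShift m M) (hB : B ∈ cornerBlock R N m) :
    (M * (1 + B)).charpoly =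
      M.charpoly - cornerPoly (fun k => (charmatrix M).adjugate k 0) B := by
  let Bc : Matrix (Fin (N + 1)) (Fin (N + 1)) R[X] := B.map C
  let w : Matrix (Fin (N + 1)) (Fin (N + 1)) R[X] :=
    Matrix.of fun i j => if (i : ℕ) ≤ j then X ^ (j - i : ℕ) else 0
  let E : Matrix (Fin (N + 1)) (Fin (N + 1)) R[X] :=
    Matrix.of fun i j => if i = 0 then X ^ (j + 1 : ℕ) else 0
  have hBc : ∀ j k : Fin (N + 1), ¬ ((j : ℕ) < m ∧ m ≤ k) → Bc j k = 0 := fun j k h => by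
    simp [Bc, hB j k h]
  have hw : ∀ i j : Fin (N + 1), ¬ (i : ℕ) ≤ j → w i j = 0 := fun i j h => if_neg h
  have hcol : ∀ r j : Fin (N + 1), (j : ℕ) < m →
      (charmatrix M * w) r j = E r j - (M.map C) r j := by
    intro r j hj
    have h1 : (charmatrix M * w) r j = X * w r j - ∑ i, C (M r i) * w i j := by
      rw [charmatrix, sub_mul, Matrix.sub_apply]
      congr 1
      · simp
    have h2 : ∑ i, C (M r i) * w i j =
        ∑ i : Fin (N + 1), if (r : ℕ) = i + 1 then w i j else 0 := by
      refine Finset.sum_congr rfl fun i _ => ?_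
      by_cases hij : (i : ℕ) ≤ j
      · rw [hM i r (by omega)]
        split_ifs <;> simp
      · simp [hw i j hij]
    rw [h1, h2, Matrix.map_apply, hM j r hj]
    obtain ⟨r, hr⟩ := r
    cases r with
    | zero =>
      simp [w, E, pow_succ']
    | succ s =>
      have h3 : ∀ i : Fin (N + 1), (s + 1 = (i : ℕ) + 1) ↔ i = ⟨s, by omega⟩ := by
        intro i
        rw [Fin.ext_iff]
        simp only
        omega
      simp only [h3, Finset.sum_ite_eq', Finset.mem_univ, if_true]
      simp only [w, E, Matrix.of_apply,
        Fin.ext_iff, Fin.val_zero, Nat.succ_ne_zero, if_false, eq_comm (a := (j : ℕ))]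
      rcases lt_trichotomy s (j : ℕ) with h | h | h
      · rw [if_pos (by omega), if_pos (by omega), if_neg (by omega), ← pow_succ',
          show (j : ℕ) - (s + 1) + 1 = j - s by omega]
        simp
      · subst h
        simp
      · rw [if_neg (by omega), if_neg (by omega), if_neg (by omega)]
        simp
  have hcolB : charmatrix M * w * Bc = E * Bc - M.map C * Bc := by
    rw [← sub_mul]
    ext1 r k
    rw [Matrix.mul_apply, Matrix.mul_apply]
    refine Finset.sum_congr rfl fun j _ => ?_
    by_cases hj : (j : ℕ) < m
    · rw [hcol r j hj]; rfl
    · rw [hBc j k (by omega), mul_zero, mul_zero]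
  have hBwB : Bc * (w * Bc) = 0 := by
    ext1 i k
    rw [Matrix.mul_apply]
    refine Finset.sum_eq_zero fun j _ => ?_
    rw [Matrix.mul_apply, Finset.mul_sum]
    refine Finset.sum_eq_zero fun l _ => ?_
    by_cases hj : m ≤ (j : ℕ)
    · by_cases hl : (l : ℕ) < m
      · simp [hw j l (by omega)]
      · rw [hBc l k (by omega), mul_zero, mul_zero]
    · rw [hBc i j (by omega), zero_mul]
  have hfac : charmatrix (M * (1 + B)) = (charmatrix M - E * Bc) * (1 + w * Bc) := by
    have : charmatrix (M * (1 + B)) = charmatrix M - M.map C * Bc := by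
      simp only [charmatrix, Bc, mul_add, mul_one, map_add, RingHom.mapMatrix_apply,
        Matrix.map_mul]
      abel
    rw [this, mul_add, mul_one, sub_mul (charmatrix M), mul_assoc E, hBwB, mul_zero, sub_zero,
      ← mul_assoc, hcolB]
    abel
  have hdet : (1 + w * Bc).det = 1 := by
    have h0 : ∀ i k : Fin (N + 1), k ≤ i → (w * Bc) i k = 0 := by
      intro i k hki
      rw [Matrix.mul_apply]
      refine Finset.sum_eq_zero fun j _ => ?_
      by_cases hij : (i : ℕ) ≤ j
      · rw [hBc j k (by have := Fin.le_def.1 hki; omega), mul_zero]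
      · rw [hw i j hij, zero_mul]
    rw [Matrix.det_of_isUpperTriangular]
    · simp [h0]
    · intro i k hki
      simp only [id] at hki
      rw [Matrix.add_apply, h0 i k hki.le, Matrix.one_apply_ne hki.ne', add_zero]
  have hrow : charmatrix M - E * Bc =
      (charmatrix M).updateRow 0 (charmatrix M 0 - fun k =>
        ∑ j : Fin (N + 1), X ^ (j + 1 : ℕ) * C (B j k)) := by
    ext1 r k
    by_cases hr : r = 0
    · subst hr
      simp [E, Bc, Matrix.mul_apply]
    · rw [Matrix.updateRow_ne hr]
      simp [E, Bc, Matrix.mul_apply, hr]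
  change (charmatrix (M * (1 + B))).det = _
  rw [hfac, det_mul, hdet, mul_one, hrow, det_updateRow_sub_eq]
  rfl

theorem coeff_adjugate_charmatrix (M : Matrix (Fin (N + 1)) (Fin (N + 1)) R) (r : Fin (N + 1))
    (l : ℕ) :
    ((charmatrix M).adjugate r 0).coeff l =
      ∑ i, M r i * ((charmatrix M).adjugate i 0).coeff (l + 1) +
        if r = 0 then M.charpoly.coeff (l + 1) else 0 := by
  have h : (charmatrix M * (charmatrix M).adjugate) r 0 =
      X * (charmatrix M).adjugate r 0 - ∑ i, C (M r i) * (charmatrix M).adjugate i 0 := by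
    rw [charmatrix, sub_mul, Matrix.sub_apply]
    congr 1
    simp
  rw [mul_adjugate] at h
  have h2 := congrArg (fun q => coeff q (l + 1)) h
  simp only [coeff_sub, coeff_X_mul, finsetSum_coeff, coeff_C_mul] at h2
  rw [← sub_eq_iff_eq_add', ← h2]
  by_cases hr : r = 0 <;> simp [hr, Matrix.charpoly]

theorem sum_mul_coeff_zero_adjugate_charmatrix (M : Matrix (Fin (N + 1)) (Fin (N + 1)) R) :
    ∑ i, M 0 i * ((charmatrix M).adjugate i 0).coeff 0 = -M.charpoly.coeff 0 := by
  have h : (charmatrix M * (charmatrix M).adjugate) 0 0 =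
      X * (charmatrix M).adjugate 0 0 - ∑ i, C (M 0 i) * (charmatrix M).adjugate i 0 := by
    rw [charmatrix, sub_mul, Matrix.sub_apply]
    congr 1
    simp
  rw [mul_adjugate] at h
  have h2 := congrArg (fun q => coeff q 0) h
  simp only [coeff_sub, coeff_X_mul_zero, finsetSum_coeff, coeff_C_mul, zero_sub] at h2
  rw [eq_neg_iff_add_eq_zero, ← neg_eq_iff_add_eq_zero, ← h2]
  simp [Matrix.charpoly]

theorem coeff_adjugate_charmatrix_eq_zero_of_lt (M : Matrix (Fin (N + 1)) (Fin (N + 1)) R) {l : ℕ}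
    (hl : N < l) (r : Fin (N + 1)) : ((charmatrix M).adjugate r 0).coeff l = 0 := by
  nontriviality R
  obtain ⟨D, hD⟩ : ∃ D : ℕ, ∀ r, ((charmatrix M).adjugate r 0).natDegree < D :=
    ⟨_, fun r => Nat.lt_succ_of_le (Finset.le_sup
      (f := fun r => ((charmatrix M).adjugate r 0).natDegree) (Finset.mem_univ r))⟩
  have key : ∀ t l : ℕ, N < l → D ≤ l + t → ∀ r, ((charmatrix M).adjugate r 0).coeff l = 0 := by
    intro t
    induction t with
    | zero => exact fun l _ h r => coeff_eq_zero_of_natDegree_lt ((hD r).trans_le h)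
    | succ t ih =>
      intro l hl h r
      rw [coeff_adjugate_charmatrix, coeff_eq_zero_of_natDegree_lt (p := M.charpoly)
        (by rw [charpoly_natDegree_eq_dim]; simpa using by omega)]
      simp [ih (l + 1) (by omega) (by omega)]
  exact key D l hl (by omega) r

theorem IsShift.coeff_adjugate_charmatrix {m : ℕ} {M : Matrix (Fin (N + 1)) (Fin (N + 1)) R}
    (hM : IsShift m M) (hm : m ≤ N) (s : ℕ) (hs : s ≤ m) (r : Fin (N + 1)) (hr : s ≤ r) :
    ((charmatrix M).adjugate r 0).coeff (N - s) = if (r : ℕ) = s then 1 else 0 := by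
  nontriviality R
  induction s generalizing r with
  | zero =>
    have h1 : M.charpoly.coeff (N + 1) = 1 := by
      have := M.charpoly_monic.coeff_natDegree
      rwa [charpoly_natDegree_eq_dim, Fintype.card_fin] at this
    rw [Nat.sub_zero, _root_.coeff_adjugate_charmatrix, h1]
    rw [Finset.sum_eq_zero (fun i _ => by
      rw [coeff_adjugate_charmatrix_eq_zero_of_lt M (Nat.lt_succ_self N) i, mul_zero]), zero_add]
    simp
  | succ s ih =>
    have hr0 : r ≠ 0 := by rintro rfl; simp at hr
    rw [_root_.coeff_adjugate_charmatrix, if_neg hr0, add_zero, show N - (s + 1) + 1 = N - s by omega]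
    rw [Finset.sum_eq_single (⟨s, by omega⟩ : Fin (N + 1))]
    · rw [ih (by omega) _ le_rfl, hM _ _ (by simp; omega)]
      simp
    · intro i _ hi
      rw [Ne, Fin.ext_iff] at hi
      simp only at hi
      rcases lt_or_gt_of_ne hi with h | h
      · rw [hM _ _ (by omega), if_neg (by omega), zero_mul]
      · rw [ih (by omega) i h.le, if_neg hi, mul_zero]
    · simp

theorem IsShift.exists_isUnit_coeff_zero [IsLocalRing R] {m : ℕ}
    {M : Matrix (Fin (N + 1)) (Fin (N + 1)) R} (hM : IsShift m M)
    (hc : IsUnit (M.charpoly.coeff 0)) :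
    ∃ k : Fin (N + 1), m ≤ k ∧ IsUnit (((charmatrix M).adjugate k 0).coeff 0) := by
  by_contra! h
  refine (IsLocalRing.mem_maximalIdeal _).1 ?_ (sum_mul_coeff_zero_adjugate_charmatrix M ▸ hc.neg)
  refine Ideal.sum_mem _ fun i _ => ?_
  by_cases hi : (i : ℕ) < m
  · rw [hM i 0 hi]
    simp
  · exact Ideal.mul_mem_left _ _ ((IsLocalRing.mem_maximalIdeal _).2 (h i (by omega)))

end Shift

section Equidistribution

open Polynomial Matrix

/-- If translating by a finite group `A` preserves a finite set and, on each orbit, changes `Φ`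
through a surjective homomorphism, then `Φ` is equidistributed on that set. -/
theorem card_mul_card_filter_eq_of_translation {α A W : Type*} [Fintype A] [AddCommGroup A]
    [Fintype W] [AddCommGroup W] [DecidableEq W] (s : Finset α) (τ : A → Equiv.Perm α)
    (hτ : ∀ a x, τ a x ∈ s ↔ x ∈ s) (Φ : α → W)
    (h : ∀ x ∈ s, ∃ φ : A →+ W, Function.Surjective φ ∧ ∀ a, Φ (τ a x) = Φ x - φ a) (w : W) :
    Fintype.card W * (s.filter fun x => Φ x = w).card = s.card := by
  classical
  have h1 : ∀ x ∈ s, Fintype.card W * (Finset.univ.filter fun a => Φ (τ a x) = w).card =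
      Fintype.card A := by
    intro x hx
    obtain ⟨φ, hφ, hx⟩ := h x hx
    have h2 : ∀ v : W, (Finset.univ.filter fun a => φ a = v).card =
        (Finset.univ.filter fun a => Φ (τ a x) = w).card := by
      intro v
      have h3 : (Finset.univ.filter fun a => Φ (τ a x) = w) =
          Finset.univ.filter fun a => φ a = Φ x - w := by
        ext a
        simp only [Finset.mem_filter, Finset.mem_univ, true_and, hx]
        rw [sub_eq_iff_eq_add, eq_sub_iff_add_eq, add_comm, eq_comm, add_comm]
      rw [h3]
      exact AddMonoidHom.card_fiber_eq_of_mem_range φ (hφ _) (hφ _)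
    have h4 := Finset.card_eq_sum_card_fiberwise (f := φ) (s := Finset.univ) (t := Finset.univ)
      (fun _ _ => Finset.mem_coe.2 (Finset.mem_univ _))
    rw [Finset.sum_congr rfl (fun v _ => h2 v), Finset.sum_const, smul_eq_mul] at h4
    exact h4.symm
  have h5 : ∑ x ∈ s, (Finset.univ.filter fun a => Φ (τ a x) = w).card =
      Fintype.card A * (s.filter fun x => Φ x = w).card := by
    simp only [Finset.card_filter]
    rw [Finset.sum_comm, ← smul_eq_mul, ← Finset.card_univ, ← Finset.sum_const]
    refine Finset.sum_congr rfl fun a _ => ?_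
    exact Finset.sum_equiv (τ a) (fun x => (hτ a x).symm) (fun x _ => rfl)
  have h6 : ∑ x ∈ s, Fintype.card W * (Finset.univ.filter fun a => Φ (τ a x) = w).card =
      s.card * Fintype.card A := by
    rw [Finset.sum_congr rfl h1, Finset.sum_const, smul_eq_mul]
  rw [← Finset.mul_sum, h5] at h6
  have hA : 0 < Fintype.card A := Fintype.card_pos
  refine Nat.eq_of_mul_eq_mul_left hA ?_
  linarith

variable {R : Type*} [CommRing R] {N : ℕ}

theorem coeff_charpolyRev (M : Matrix (Fin (N + 1)) (Fin (N + 1)) R) {i : ℕ} (hi : i ≤ N + 1) :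
    M.charpolyRev.coeff i = M.charpoly.coeff (N + 1 - i) := by
  nontriviality R
  rw [← reverse_charpoly, coeff_reverse, charpoly_natDegree_eq_dim, Fintype.card_fin, revAt_le hi]

theorem coeff_zero_mul_charpolyRev_inv (M : (Matrix (Fin (N + 1)) (Fin (N + 1)) R)ˣ) (i : ℕ) :
    M.1.charpoly.coeff 0 * (M⁻¹).1.charpolyRev.coeff i = M.1.charpoly.coeff i := by
  have h := charpoly_inv (M⁻¹).1 (M⁻¹).isUnit
  rw [← coe_units_inv, inv_inv, show ((-1 : R[X]) ^ Fintype.card (Fin (N + 1))) =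
    C ((-1) ^ Fintype.card (Fin (N + 1))) by simp, ← C_mul] at h
  rw [h, coeff_C_mul, coeff_C_mul, coeff_zero_eq_eval_zero (M⁻¹).1.charpolyRev, eval_charpolyRev,
    mul_one]

theorem isUnit_coeff_zero_charpoly (M : (Matrix (Fin (N + 1)) (Fin (N + 1)) R)ˣ) :
    IsUnit (M.1.charpoly.coeff 0) := by
  have h := (isUnit_iff_isUnit_det M.1).1 M.isUnit
  rw [det_eq_sign_charpoly_coeff] at h
  exact isUnit_of_mul_isUnit_right h

/-- The first coefficients of `det (1 - X M)` and of `det (1 - X M⁻¹)`. -/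
noncomputable def charCoeffs (d₁ d₂ : ℕ) (M : (Matrix (Fin (N + 1)) (Fin (N + 1)) R)ˣ) :
    (Fin d₁ → R) × (Fin d₂ → R) :=
  (fun i => M.1.charpolyRev.coeff (i + 1), fun i => (M⁻¹).1.charpolyRev.coeff (i + 1))

theorem charCoeffs_conj (d₁ d₂ : ℕ) (g M : (Matrix (Fin (N + 1)) (Fin (N + 1)) R)ˣ) :
    charCoeffs d₁ d₂ (g * M * g⁻¹) = charCoeffs d₁ d₂ M := by
  have h : ∀ M : (Matrix (Fin (N + 1)) (Fin (N + 1)) R)ˣ,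
      (g * M * g⁻¹).1.charpolyRev = M.1.charpolyRev := fun M => by
    rw [← reverse_charpoly, ← reverse_charpoly, Units.val_mul, Units.val_mul, coe_units_inv,
      charpoly_units_conj]
  unfold charCoeffs
  rw [h, show (g * M * g⁻¹)⁻¹ = g * M⁻¹ * g⁻¹ by group, h]

/-- `1 + B` as a unit, for `B` in the corner block. -/
def cornerUnit {m : ℕ} (B : cornerBlock R N m) : (Matrix (Fin (N + 1)) (Fin (N + 1)) R)ˣ where
  val := 1 + B.1
  inv := 1 - B.1
  val_inv := by simp [mul_sub, add_mul, cornerBlock_mul B.2 B.2]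
  inv_val := by simp [mul_add, sub_mul, cornerBlock_mul B.2 B.2]

theorem isShift_mul_cornerUnit {m : ℕ} (B : cornerBlock R N m)
    (M : Matrix (Fin (N + 1)) (Fin (N + 1)) R) :
    IsShift m (M * (cornerUnit B).1) ↔ IsShift m M := by
  have h : ∀ a r : Fin (N + 1), (a : ℕ) < m → (M * (cornerUnit B).1) r a = M r a := by
    intro a r ha
    simp only [cornerUnit, mul_add, mul_one, Matrix.add_apply, add_eq_left]
    rw [Matrix.mul_apply]
    exact Finset.sum_eq_zero fun j _ => by rw [B.2 j a (by omega), mul_zero]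
  unfold IsShift
  exact forall_congr' fun a => forall_congr' fun r => imp_congr_right fun ha => by rw [h a r ha]

theorem coeff_zero_cornerPoly (Q : Fin (N + 1) → R[X])
    (B : Matrix (Fin (N + 1)) (Fin (N + 1)) R) : (cornerPoly Q B).coeff 0 = 0 := by
  simp [cornerPoly, finsetSum_coeff, mul_coeff_zero]

theorem IsShift.surjective_coeff_cornerPoly [IsLocalRing R] [Finite R] {d₁ d₂ : ℕ}
    (hN : d₁ + d₂ ≤ N) {M : Matrix (Fin (N + 1)) (Fin (N + 1)) R} (hM : IsShift (d₁ + d₂) M)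
    (hc : IsUnit (M.charpoly.coeff 0)) (w : (Fin d₁ → R) × (Fin d₂ → R)) :
    ∃ B ∈ cornerBlock R N (d₁ + d₂),
      (∀ i : Fin d₁, (cornerPoly (fun k => (charmatrix M).adjugate k 0) B).coeff (N - i) = w.1 i) ∧
      ∀ i : Fin d₂, (cornerPoly (fun k => (charmatrix M).adjugate k 0) B).coeff (i + 1) =
        w.2 i := by
  obtain ⟨k₀, hk₀, hu⟩ := hM.exists_isUnit_coeff_zero hc
  set Q : Fin (N + 1) → R[X] := fun k => (charmatrix M).adjugate k 0 with hQ
  let km : Fin (N + 1) := ⟨d₁ + d₂, by omega⟩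
  have htop : ∀ l : ℕ, N - (d₁ + d₂) ≤ l → (Q km).coeff l = if l = N - (d₁ + d₂) then 1 else 0 := by
    intro l hl
    by_cases hlN : N < l
    · rw [hQ, coeff_adjugate_charmatrix_eq_zero_of_lt M hlN, if_neg (by omega)]
    · obtain ⟨s, hs, rfl⟩ : ∃ s, s ≤ d₁ + d₂ ∧ l = N - s := ⟨N - l, by omega, by omega⟩
      rw [hQ, hM.coeff_adjugate_charmatrix hN s hs km hs]
      exact if_congr (by simp only [km]; omega) rfl rfl
  have hlow : ∀ l : ℕ, N - (d₁ + d₂) < l → (Q k₀).coeff l = 0 := by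
    intro l hl
    by_cases hlN : N < l
    · exact coeff_adjugate_charmatrix_eq_zero_of_lt M hlN k₀
    · obtain ⟨s, hs, rfl⟩ : ∃ s, s < d₁ + d₂ ∧ l = N - s := ⟨N - l, by omega, by omega⟩
      rw [hQ, hM.coeff_adjugate_charmatrix hN s hs.le k₀ (by omega), if_neg (by omega)]
  let f : (Fin d₁ → R) → Fin d₁ → R := fun x i =>
    ∑ a : Fin d₁, (X ^ (d₁ + d₂ - a) * C (x a) * Q km).coeff (N - i)
  let g : (Fin d₂ → R) → Fin d₂ → R := fun y i =>
    ∑ b : Fin d₂, (X ^ (b + 1 : ℕ) * C (y b) * Q k₀).coeff (i + 1)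
  have hf : Function.Bijective f := by
    refine bijective_of_triangular f (fun _ => 1) (fun _ => isUnit_one) fun i x y hxy => ?_
    simp only [f, one_mul]
    rw [← Finset.add_sum_erase _ _ (Finset.mem_univ i),
      ← Finset.add_sum_erase _ _ (Finset.mem_univ i)]
    have h1 : ∀ z : R, (X ^ (d₁ + d₂ - i) * C z * Q km).coeff (N - i) = z := by
      intro z
      rw [mul_assoc, coeff_X_pow_mul', if_pos (by omega), coeff_C_mul, htop _ (by omega),
        if_pos (by omega), mul_one]
    rw [h1, h1, add_sub_cancel_left, add_sub_cancel_left]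
    refine Finset.sum_congr rfl fun a ha => ?_
    rcases lt_trichotomy a i with hai | hai | hai
    · rw [hxy a hai]
    · exact absurd hai (Finset.ne_of_mem_erase ha)
    · have h2 : ∀ z : R, (X ^ (d₁ + d₂ - a) * C z * Q km).coeff (N - i) = 0 := by
        intro z
        have := Fin.lt_def.1 hai
        rw [mul_assoc, coeff_X_pow_mul', if_pos (by omega), coeff_C_mul, htop _ (by omega),
          if_neg (by omega), mul_zero]
      rw [h2, h2]
  have hg : Function.Bijective g := by
    refine bijective_of_triangular g (fun _ => (Q k₀).coeff 0) (fun _ => hu) fun i x y hxy => ?_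
    simp only [g]
    rw [← Finset.add_sum_erase _ _ (Finset.mem_univ i),
      ← Finset.add_sum_erase _ _ (Finset.mem_univ i)]
    have h1 : ∀ z : R, (X ^ (i + 1 : ℕ) * C z * Q k₀).coeff (i + 1) = (Q k₀).coeff 0 * z := by
      intro z
      rw [mul_assoc, coeff_X_pow_mul', if_pos le_rfl, coeff_C_mul, Nat.sub_self, mul_comm]
    rw [h1, h1, add_sub_cancel_left, add_sub_cancel_left]
    refine Finset.sum_congr rfl fun a ha => ?_
    rcases lt_trichotomy a i with hai | hai | hai
    · rw [hxy a hai]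
    · exact absurd hai (Finset.ne_of_mem_erase ha)
    · have h2 : ∀ z : R, (X ^ (a + 1 : ℕ) * C z * Q k₀).coeff (i + 1) = 0 := by
        intro z
        have := Fin.lt_def.1 hai
        rw [mul_assoc, coeff_X_pow_mul', if_neg (by omega)]
      rw [h2, h2]
  obtain ⟨x, hx⟩ := hf.2 w.1
  obtain ⟨y, hy⟩ := hg.2 w.2
  refine ⟨∑ a : Fin d₁, Matrix.single ⟨d₁ + d₂ - 1 - a, by omega⟩ km (x a) +
    ∑ b : Fin d₂, Matrix.single ⟨b, by omega⟩ k₀ (y b), ?_, ?_, ?_⟩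
  · refine add_mem (sum_mem fun a _ => ?_) (sum_mem fun b _ => ?_)
    · intro j k hjk
      refine Matrix.single_apply_of_ne _ _ _ _ _ ?_
      rintro ⟨rfl, rfl⟩
      exact hjk ⟨by simp only; omega, le_rfl⟩
    · intro j k hjk
      refine Matrix.single_apply_of_ne _ _ _ _ _ ?_
      rintro ⟨rfl, rfl⟩
      exact hjk ⟨by simp only; omega, hk₀⟩
  · intro i
    simp only [map_add, map_sum, cornerPoly_single, coeff_add, finsetSum_coeff]
    rw [Finset.sum_eq_zero (s := (Finset.univ : Finset (Fin d₂))), add_zero, ← hx]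
    · refine Finset.sum_congr rfl fun a _ => ?_
      rw [show d₁ + d₂ - 1 - (a : ℕ) + 1 = d₁ + d₂ - a by omega]
    · intro b _
      rw [mul_assoc, coeff_X_pow_mul']
      split_ifs
      · rw [coeff_C_mul, hlow _ (by omega), mul_zero]
      · rfl
  · intro i
    simp only [map_add, map_sum, cornerPoly_single, coeff_add, finsetSum_coeff]
    rw [Finset.sum_eq_zero (s := (Finset.univ : Finset (Fin d₁))), zero_add, ← hy]
    intro a _
    rw [mul_assoc, coeff_X_pow_mul', if_neg (by omega)]

open scoped Classical in
theorem card_shift_filter [IsLocalRing R] [Fintype R] {d₁ d₂ : ℕ} (hN : d₁ + d₂ ≤ N)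
    (w : (Fin d₁ → R) × (Fin d₂ → R)) :
    Fintype.card ((Fin d₁ → R) × (Fin d₂ → R)) *
      (Finset.univ.filter fun M : (Matrix (Fin (N + 1)) (Fin (N + 1)) R)ˣ =>
        IsShift (d₁ + d₂) M.1 ∧ charCoeffs d₁ d₂ M = w).card =
      (Finset.univ.filter fun M : (Matrix (Fin (N + 1)) (Fin (N + 1)) R)ˣ =>
        IsShift (d₁ + d₂) M.1).card := by
  rw [← Finset.filter_filter]
  refine card_mul_card_filter_eq_of_translation (A := cornerBlock R N (d₁ + d₂)) _
    (fun B => Equiv.mulRight (cornerUnit B)) ?_ _ ?_ w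
  · intro B M
    simp only [Finset.mem_filter, Finset.mem_univ, true_and, Equiv.coe_mulRight, Units.val_mul]
    exact isShift_mul_cornerUnit B M.1
  · intro M hM
    rw [Finset.mem_filter] at hM
    replace hM := hM.2
    obtain ⟨c, hc⟩ := isUnit_coeff_zero_charpoly M
    let Q : Fin (N + 1) → R[X] := fun k => (charmatrix M.1).adjugate k 0
    let φ : cornerBlock R N (d₁ + d₂) →+ (Fin d₁ → R) × (Fin d₂ → R) :=
      { toFun := fun B => (fun i => (cornerPoly Q B.1).coeff (N - i),
          fun i => ↑c⁻¹ * (cornerPoly Q B.1).coeff (i + 1))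
        map_zero' := by ext <;> simp
        map_add' := fun B B' => by ext <;> simp [mul_add] }
    refine ⟨φ, fun w => ?_, fun B => ?_⟩
    · obtain ⟨B, hB, h1, h2⟩ := hM.surjective_coeff_cornerPoly hN (isUnit_coeff_zero_charpoly M)
        (w.1, fun i => c * w.2 i)
      refine ⟨⟨B, hB⟩, Prod.ext (funext h1) (funext fun i => ?_)⟩
      change ↑c⁻¹ * (cornerPoly Q B).coeff (i + 1) = _
      rw [h2, Units.inv_mul_cancel_left]
    · have key : (M * cornerUnit B).1.charpoly = M.1.charpoly - cornerPoly Q B.1 :=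
        charpoly_mul_one_add hM B.2
      have h0 : (M * cornerUnit B).1.charpoly.coeff 0 = c := by
        rw [key, coeff_sub, coeff_zero_cornerPoly, sub_zero, hc]
      refine Prod.ext (funext fun i => ?_) (funext fun i => ?_)
      · change (M * cornerUnit B).1.charpolyRev.coeff (i + 1) =
          M.1.charpolyRev.coeff (i + 1) - (cornerPoly Q B.1).coeff (N - i)
        rw [coeff_charpolyRev _ (by omega), coeff_charpolyRev _ (by omega), key, coeff_sub,
          show N + 1 - ((i : ℕ) + 1) = N - i by omega]
      · change ((M * cornerUnit B)⁻¹).1.charpolyRev.coeff (i + 1) =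
          (M⁻¹).1.charpolyRev.coeff (i + 1) - ↑c⁻¹ * (cornerPoly Q B.1).coeff (i + 1)
        refine c.isUnit.mul_left_cancel ?_
        rw [mul_sub, Units.mul_inv_cancel_left, hc, coeff_zero_mul_charpolyRev_inv, ← hc, ← h0,
          coeff_zero_mul_charpolyRev_inv, key, coeff_sub]

end Equidistribution

section Counting

open Matrix

theorem exists_isUnit_det_extend_columns {F : Type*} [Field F] {m N : ℕ} (hm : m ≤ N)
    (u : Fin m → Fin N → F) (hu : LinearIndependent F u) :
    ∃ h : Matrix (Fin N) (Fin N) F, IsUnit h.det ∧ ∀ a r, h r (Fin.castLE hm a) = u a r := by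
  let w : Fin m → Fin N → F := fun a => Pi.single (Fin.castLE hm a) 1
  have hw : LinearIndependent F w := by
    have := (Pi.basisFun F (Fin N)).linearIndependent.comp _ (Fin.castLE_injective hm)
    convert this using 1
    ext a
    simp [w]
  obtain ⟨g, hg⟩ := Submodule.exists_linearEquiv_restrict_eq
    (hw.linearCombinationEquiv.symm ≪≫ₗ hu.linearCombinationEquiv)
  have hgw : ∀ a, g (w a) = u a := by
    intro a
    have h1 : (hw.linearCombinationEquiv (Finsupp.single a 1) : Fin N → F) = w a := by simp
    rw [← h1, ← hg]
    simp
  refine ⟨LinearMap.toMatrix' (g : (Fin N → F) →ₗ[F] Fin N → F), ?_, fun a r => ?_⟩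
  · rw [LinearMap.det_toMatrix']
    exact LinearEquiv.isUnit_det' g
  · rw [LinearMap.toMatrix'_apply, ← hgw]
    rfl

variable {R : Type*} [CommRing R] {N : ℕ}

/-- The vectors `v` occur as columns `1, …, m` of an invertible matrix whose column `0` is `e₀`. -/
def IsExtendable {m : ℕ} (v : Fin m → Fin (N + 1) → R) : Prop :=
  ∃ g : (Matrix (Fin (N + 1)) (Fin (N + 1)) R)ˣ, (∀ r, g.1 r 0 = if r = 0 then 1 else 0) ∧
    ∀ (a : Fin m) (j r : Fin (N + 1)), (j : ℕ) = a + 1 → g.1 r j = v a r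

/-- The vectors `M e₀, …, M^m e₀`. -/
def krylov (m : ℕ) (M : (Matrix (Fin (N + 1)) (Fin (N + 1)) R)ˣ) : Fin m → Fin (N + 1) → R :=
  fun a r => (M.1 ^ (a + 1 : ℕ)) r 0

theorem isExtendable_of_linearIndependent {F : Type*} [Field F] (ρ : R →+* F) [IsLocalHom ρ]
    (hρ : Function.Surjective ρ) {m : ℕ} (hm : m ≤ N) (v : Fin m → Fin (N + 1) → R)
    (hv : LinearIndependent F fun (a : Fin m) (r : Fin N) => ρ (v a r.succ)) : IsExtendable v := by
  obtain ⟨h, hh, hcol⟩ := exists_isUnit_det_extend_columns hm _ hv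
  choose σ hσ using hρ
  let g : Matrix (Fin (N + 1)) (Fin (N + 1)) R := Matrix.of fun r j =>
    if hj : j = 0 then if r = 0 then 1 else 0
    else if hj' : (j : ℕ) - 1 < m then v ⟨j - 1, hj'⟩ r
    else if hr : r = 0 then 0 else σ (h (r.pred hr) (j.pred hj))
  have hsub : (g.submatrix Fin.succ Fin.succ).map ρ = h := by
    ext r j
    by_cases hj : (j : ℕ) < m
    · have := hcol ⟨j, hj⟩ r
      simp only [Fin.castLE_mk, Fin.eta] at this
      simp [g, hj, this]
    · simp [g, hj, hσ]
  have hdet : g.det = (g.submatrix Fin.succ Fin.succ).det := by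
    rw [det_succ_column_zero, Finset.sum_eq_single 0]
    · simp [g]
    · intro i _ hi
      simp [g, hi]
    · simp
  have hgu : IsUnit g := by
    rw [isUnit_iff_isUnit_det, hdet]
    refine (isUnit_map_iff ρ _).1 ?_
    rw [RingHom.map_det, RingHom.mapMatrix_apply, hsub]
    exact hh
  obtain ⟨g', hg'⟩ := hgu
  refine ⟨g', fun r => ?_, fun a j r hj => ?_⟩
  · rw [hg']
    simp [g]
  · have hj0 : j ≠ 0 := by rintro rfl; simp at hj
    have hj' : (j : ℕ) - 1 < m := by omega
    have ha : (⟨(j : ℕ) - 1, hj'⟩ : Fin m) = a := Fin.ext (by simp only; omega)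
    rw [hg']
    simp only [g, Matrix.of_apply, dif_neg hj0, dif_pos hj', ha]

open scoped Classical in
theorem card_not_isExtendable_le [Fintype R] {F : Type*} [Field F] [Fintype F] (ρ : R →+* F)
    [IsLocalHom ρ] (hρ : Function.Surjective ρ) {m : ℕ} (hm : m ≤ N) :
    Fintype.card F ^ N *
      (Finset.univ.filter fun v : Fin m → Fin (N + 1) → R => ¬ IsExtendable v).card ≤
      Fintype.card F ^ m * Fintype.card (Fin m → Fin (N + 1) → R) := by
  let ψ : (Fin m → F) → (Fin m → Fin (N + 1) → R) →+ (Fin N → F) := fun c =>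
    { toFun := fun v r => ∑ a, c a * ρ (v a r.succ)
      map_zero' := by ext; simp
      map_add' := fun v v' => by ext; simp [mul_add, Finset.sum_add_distrib] }
  have hψ : ∀ c, c ≠ 0 → Function.Surjective (ψ c) := by
    intro c hc w
    obtain ⟨a, ha⟩ := Function.ne_iff.1 hc
    simp only [Pi.zero_apply] at ha
    choose σ hσ using hρ
    refine ⟨fun b r => if b = a then Fin.cases 0 (fun r => σ ((c a)⁻¹ * w r)) r else 0, ?_⟩
    ext r
    change ∑ b, c b * ρ _ = _
    rw [Finset.sum_eq_single a]
    · simp [hσ, ha]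
    · intro b _ hb
      simp [hb]
    · simp
  have hsub : (Finset.univ.filter fun v : Fin m → Fin (N + 1) → R => ¬ IsExtendable v) ⊆
      (Finset.univ.filter fun c : Fin m → F => c ≠ 0).biUnion fun c =>
        Finset.univ.filter fun v => ψ c v = 0 := by
    intro v hv
    rw [Finset.mem_filter] at hv
    have h1 := mt (isExtendable_of_linearIndependent ρ hρ hm v) hv.2
    rw [Fintype.not_linearIndependent_iff] at h1
    obtain ⟨c, hc, a, ha⟩ := h1
    simp only [Finset.mem_biUnion, Finset.mem_filter, Finset.mem_univ, true_and]
    refine ⟨c, fun h => ha (congrFun h a), ?_⟩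
    ext r
    have := congrFun hc r
    simpa [ψ] using this
  have hker : ∀ c, c ≠ 0 → Fintype.card F ^ N *
      (Finset.univ.filter fun v => ψ c v = 0).card = Fintype.card (Fin m → Fin (N + 1) → R) := by
    intro c hc
    have h4 := Finset.card_eq_sum_card_fiberwise (f := ψ c) (s := Finset.univ) (t := Finset.univ)
      (fun _ _ => Finset.mem_coe.2 (Finset.mem_univ _))
    rw [Finset.sum_congr rfl (fun w _ => AddMonoidHom.card_fiber_eq_of_mem_range (ψ c)
      (hψ c hc w) (hψ c hc 0)), Finset.sum_const, smul_eq_mul] at h4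
    simpa using h4.symm
  calc _ ≤ Fintype.card F ^ N * ∑ c ∈ Finset.univ.filter fun c : Fin m → F => c ≠ 0,
          (Finset.univ.filter fun v => ψ c v = 0).card :=
        Nat.mul_le_mul_left _ ((Finset.card_le_card hsub).trans Finset.card_biUnion_le)
    _ = (Finset.univ.filter fun c : Fin m → F => c ≠ 0).card *
          Fintype.card (Fin m → Fin (N + 1) → R) := by
        rw [Finset.mul_sum, Finset.sum_congr rfl fun c hc => hker c (Finset.mem_filter.1 hc).2,
          Finset.sum_const, smul_eq_mul]
    _ ≤ _ := by
        refine Nat.mul_le_mul_right _ ((Finset.card_filter_le _ _).trans ?_)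
        simp

theorem krylov_eq_iff_isShift {m : ℕ} (hm : m ≤ N) {v : Fin m → Fin (N + 1) → R}
    {g : (Matrix (Fin (N + 1)) (Fin (N + 1)) R)ˣ} (hg0 : ∀ r, g.1 r 0 = if r = 0 then 1 else 0)
    (hg : ∀ (a : Fin m) (j r : Fin (N + 1)), (j : ℕ) = a + 1 → g.1 r j = v a r)
    (M : (Matrix (Fin (N + 1)) (Fin (N + 1)) R)ˣ) :
    krylov m (g * M * g⁻¹) = v ↔ IsShift m M.1 := by
  have hpow : ∀ a : ℕ, ((g * M * g⁻¹).1 ^ a) = g.1 * M.1 ^ a * g⁻¹.1 := by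
    intro a
    rw [← Units.val_pow_eq_pow_val, conj_pow]
    simp
  have hginv : ∀ r, g⁻¹.1 r 0 = if r = 0 then 1 else 0 := by
    intro r
    have h1 : (g⁻¹.1 * g.1) r 0 = g⁻¹.1 r 0 := by
      rw [Matrix.mul_apply]
      simp [hg0]
    rw [← h1, Units.inv_mul, Matrix.one_apply]
  have hcol : ∀ a r, ((g * M * g⁻¹).1 ^ a) r 0 = (g.1 *ᵥ fun s => (M.1 ^ a) s 0) r := by
    intro a r
    rw [hpow, Matrix.mul_apply]
    simp only [hginv, mul_ite, mul_one, mul_zero, Finset.sum_ite_eq', Finset.mem_univ, if_true]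
    rfl
  have hshift : ∀ j r : Fin (N + 1), g.1 r j = (g.1 *ᵥ Pi.single j 1) r := by
    intro j r
    simp
  have hinj : Function.Injective fun x : Fin (N + 1) → R => g.1 *ᵥ x :=
    mulVec_injective_of_isUnit g.isUnit
  have h1 : krylov m (g * M * g⁻¹) = v ↔
      ∀ a j : Fin (N + 1), (a : ℕ) < m → (j : ℕ) = a + 1 →
        (fun s => (M.1 ^ (j : ℕ)) s 0) = Pi.single j 1 := by
    constructor
    · intro h a j ha hj
      apply hinj
      ext r
      change (g.1 *ᵥ _) r = (g.1 *ᵥ _) r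
      rw [← hcol, ← hshift, hg ⟨a, ha⟩ j r hj, ← h, krylov, hj]
    · intro h
      ext a r
      have := h ⟨a, by omega⟩ ⟨a + 1, by omega⟩ a.2 rfl
      simp only at this
      rw [krylov, hcol, this, ← hshift, hg a _ r rfl]
  rw [h1]
  have hsucc : ∀ (a : ℕ) (ha : a < N + 1), (fun s => (M.1 ^ a) s 0) = Pi.single ⟨a, ha⟩ 1 →
      ∀ r, (M.1 ^ (a + 1)) r 0 = M.1 r ⟨a, ha⟩ := by
    intro a ha h r
    rw [pow_succ', Matrix.mul_apply]
    change ∑ j, M.1 r j * (fun s => (M.1 ^ a) s 0) j = _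
    rw [h]
    simp [Pi.single_apply]
  constructor
  · intro h a r ha
    have h2 : (fun s => (M.1 ^ (a : ℕ)) s 0) = Pi.single a 1 := by
      obtain ⟨a, haN⟩ := a
      cases a with
      | zero => ext s; simp [Matrix.one_apply, Pi.single_apply]
      | succ b => exact h ⟨b, by omega⟩ ⟨b + 1, haN⟩ (by simp only at ha ⊢; omega) rfl
    have h3 := h a ⟨a + 1, by omega⟩ ha rfl
    rw [← hsucc a a.2 h2 r]
    have h4 := congrFun h3 r
    simp only at h4
    rw [h4, Pi.single_apply]
    exact if_congr (by rw [Fin.ext_iff]) rfl rfl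
  · intro h a j ha hj
    have h5 : ∀ b : ℕ, (hb : b < N + 1) → b ≤ m → (fun s => (M.1 ^ b) s 0) = Pi.single ⟨b, hb⟩ 1 := by
      intro b
      induction b with
      | zero => intro _ _; ext s; simp [Matrix.one_apply, Pi.single_apply]
      | succ b ih =>
        intro hb hbm
        ext r
        rw [hsucc b (by omega) (ih _ (by omega)), h _ _ (by simp only; omega), Pi.single_apply]
        exact if_congr (by rw [Fin.ext_iff]) rfl rfl
    exact h5 j j.2 (by omega)

open scoped Classical in
theorem card_filter_isExtendable_krylov [Fintype R] {m : ℕ} (hm : m ≤ N)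
    (P : (Matrix (Fin (N + 1)) (Fin (N + 1)) R)ˣ → Prop) (hP : ∀ g M, P (g * M * g⁻¹) ↔ P M) :
    (Finset.univ.filter fun M => IsExtendable (krylov m M) ∧ P M).card =
      (Finset.univ.filter fun v : Fin m → Fin (N + 1) → R => IsExtendable v).card *
        (Finset.univ.filter fun M => IsShift m M.1 ∧ P M).card := by
  rw [Finset.card_eq_sum_card_fiberwise (f := krylov m)
    (t := Finset.univ.filter fun v : Fin m → Fin (N + 1) → R => IsExtendable v)
    (fun M hM => by simpa using (Finset.mem_filter.1 hM).2.1), ← smul_eq_mul, ← Finset.sum_const]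
  refine Finset.sum_congr rfl fun v hv => ?_
  have hv' := (Finset.mem_filter.1 hv).2
  obtain ⟨g, hg0, hg⟩ := (Finset.mem_filter.1 hv).2
  symm
  refine Finset.card_equiv (MulAut.conj g).toEquiv fun M => ?_
  change _ ↔ g * M * g⁻¹ ∈ _
  simp only [Finset.mem_filter, Finset.mem_univ, true_and, hP, ← krylov_eq_iff_isShift hm hg0 hg M]
  constructor
  · rintro ⟨rfl, h⟩
    exact ⟨⟨hv', h⟩, rfl⟩
  · rintro ⟨⟨_, h⟩, h'⟩
    exact ⟨h', h⟩

open scoped Classical in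
theorem card_units_matrix_le [Fintype R] {m : ℕ} (hm : m ≤ N) :
    Fintype.card (Matrix (Fin (N + 1)) (Fin (N + 1)) R)ˣ ≤
      Fintype.card (Fin m → Fin (N + 1) → R) *
        (Finset.univ.filter fun M : (Matrix (Fin (N + 1)) (Fin (N + 1)) R)ˣ =>
          IsShift m M.1).card := by
  let κ : (Matrix (Fin (N + 1)) (Fin (N + 1)) R)ˣ → Fin m → Fin (N + 1) → R :=
    fun M a r => M.1 r ⟨a, by omega⟩
  let S₀ : (Matrix (Fin (N + 1)) (Fin (N + 1)) R)ˣ :=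
    { val := (1 : Matrix _ _ R).submatrix id (finRotate (N + 1))
      inv := (1 : Matrix _ _ R).submatrix (finRotate (N + 1)) id
      val_inv := by rw [submatrix_mul_equiv, mul_one, submatrix_id_id]
      inv_val := by
        rw [← submatrix_mul _ _ _ _ _ Function.bijective_id, mul_one, submatrix_one_equiv] }
  have hS₀ : IsShift m S₀.1 := by
    intro a r ha
    simp only [S₀, Matrix.submatrix_apply, id, Matrix.one_apply]
    refine if_congr ?_ rfl rfl
    rw [Fin.ext_iff, coe_finRotate_of_ne_last]
    rintro rfl
    simp at ha
    omega
  rw [← Finset.card_univ, Finset.card_eq_sum_card_fiberwise (f := κ) (t := Finset.univ)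
    (fun _ _ => Finset.mem_coe.2 (Finset.mem_univ _))]
  rw [← Finset.card_univ, ← smul_eq_mul, ← Finset.sum_const]
  refine Finset.sum_le_sum fun v _ => ?_
  rcases Finset.eq_empty_or_nonempty (Finset.univ.filter fun M => κ M = v) with h | ⟨M₀, hM₀⟩
  · rw [h]
    simp
  · rw [Finset.mem_filter] at hM₀
    refine Finset.card_le_card_of_injOn (fun M => S₀ * M₀⁻¹ * M) ?_ ?_
    · intro M hM
      have hM := (Finset.mem_filter.1 hM).2
      refine Finset.mem_coe.2 (Finset.mem_filter.2 ⟨Finset.mem_univ _, fun a r ha => ?_⟩)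
      have h1 : ∀ s, M.1 s a = M₀.1 s a := fun s =>
        congrFun (congrFun (hM.trans hM₀.2.symm) ⟨a, ha⟩) s
      have h2 : (S₀ * M₀⁻¹ * M).1 r a = (S₀ * M₀⁻¹ * M₀).1 r a := by
        rw [Units.val_mul, Units.val_mul (S₀ * M₀⁻¹), Matrix.mul_apply, Matrix.mul_apply]
        simp only [h1]
      rw [h2, inv_mul_cancel_right]
      exact hS₀ a r ha
    · intro M _ M' _ h
      exact mul_left_cancel h

open scoped Classical in
theorem abs_card_charCoeffs_sub_le [IsLocalRing R] [Fintype R] {F : Type*} [Field F] [Fintype F]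
    (ρ : R →+* F) [IsLocalHom ρ] (hρ : Function.Surjective ρ) {d₁ d₂ : ℕ} (hN : d₁ + d₂ ≤ N)
    (A : Finset ((Fin d₁ → R) × (Fin d₂ → R))) :
    |((Finset.univ.filter fun M : (Matrix (Fin (N + 1)) (Fin (N + 1)) R)ˣ =>
          charCoeffs d₁ d₂ M ∈ A).card : ℝ) /
        Fintype.card (Matrix (Fin (N + 1)) (Fin (N + 1)) R)ˣ -
      A.card / Fintype.card ((Fin d₁ → R) × (Fin d₂ → R))| ≤
      (Fintype.card F : ℝ) ^ (d₁ + d₂) / (Fintype.card F : ℝ) ^ N := by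
  set m := d₁ + d₂ with hm
  set V := (Finset.univ.filter fun v : Fin m → Fin (N + 1) → R => IsExtendable v).card
  set S := (Finset.univ.filter fun M : (Matrix (Fin (N + 1)) (Fin (N + 1)) R)ˣ =>
    IsShift m M.1).card
  set G := Fintype.card (Matrix (Fin (N + 1)) (Fin (N + 1)) R)ˣ
  set All := Fintype.card (Fin m → Fin (N + 1) → R) with hAll
  set E := Finset.univ.filter fun M : (Matrix (Fin (N + 1)) (Fin (N + 1)) R)ˣ =>
    IsExtendable (krylov m M)
  set W := Fintype.card ((Fin d₁ → R) × (Fin d₂ → R))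
  have hE : E.card = V * S := by
    have := card_filter_isExtendable_krylov hN (R := R) (fun _ => True) (fun _ _ => Iff.rfl)
    simpa using this
  have hEw : ∀ w, W * (E.filter fun M => charCoeffs d₁ d₂ M = w).card = E.card := by
    intro w
    have h1 := card_filter_isExtendable_krylov hN
      (fun M => charCoeffs d₁ d₂ M = w) (fun g M => by rw [charCoeffs_conj])
    have h2 := card_shift_filter hN w
    have h3 : (E.filter fun M => charCoeffs d₁ d₂ M = w).card =
        V * (Finset.univ.filter fun M : (Matrix (Fin (N + 1)) (Fin (N + 1)) R)ˣ =>
          IsShift m M.1 ∧ charCoeffs d₁ d₂ M = w).card := by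
      rw [Finset.filter_filter]
      convert h1
    rw [h3, hE, mul_left_comm]
    convert congrArg (V * ·) h2
  have hEA : W * (E.filter fun M => charCoeffs d₁ d₂ M ∈ A).card = A.card * E.card := by
    rw [Finset.card_eq_sum_card_fiberwise (f := charCoeffs d₁ d₂) (t := A)
      (fun M hM => Finset.mem_coe.2 (Finset.mem_filter.1 hM).2), Finset.mul_sum,
      ← smul_eq_mul, ← Finset.sum_const]
    refine Finset.sum_congr rfl fun w hw => ?_
    rw [← hEw w, Finset.filter_filter]
    congr 2
    refine Finset.filter_congr fun M _ => ⟨fun h => h.2, fun h => ⟨h ▸ hw, h⟩⟩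
  have hG : G ≤ All * S := card_units_matrix_le hN
  have hV : Fintype.card F ^ N * All ≤ Fintype.card F ^ N * V + Fintype.card F ^ m * All := by
    have h1 := card_not_isExtendable_le ρ hρ hN
    have h2 := Finset.card_filter_add_card_filter_not (s := Finset.univ)
      (fun v : Fin m → Fin (N + 1) → R => IsExtendable v)
    rw [Finset.card_univ] at h2
    rw [hAll, ← h2, mul_add, h2]
    exact Nat.add_le_add_left h1 _
  set T := Finset.univ.filter fun M : (Matrix (Fin (N + 1)) (Fin (N + 1)) R)ˣ =>
    charCoeffs d₁ d₂ M ∈ A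
  have hT1 : (E.filter fun M => charCoeffs d₁ d₂ M ∈ A).card ≤ T.card :=
    Finset.card_le_card (Finset.filter_subset_filter _ (Finset.subset_univ _))
  have hT2 : T.card + E.card ≤ (E.filter fun M => charCoeffs d₁ d₂ M ∈ A).card + G := by
    have h1 := Finset.card_union_add_card_inter T E
    have h2 : T ∩ E = E.filter fun M => charCoeffs d₁ d₂ M ∈ A := by
      ext M
      simp [T, and_comm]
    rw [← h1, h2, add_comm]
    exact Nat.add_le_add_left (Finset.card_le_univ _) _
  have hW : A.card ≤ W := Finset.card_le_univ _
  have hW0 : (0 : ℝ) < W := Nat.cast_pos.2 Fintype.card_pos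
  have hG0 : (0 : ℝ) < G := Nat.cast_pos.2 Fintype.card_pos
  have hq : (1 : ℝ) < Fintype.card F := by exact_mod_cast Fintype.one_lt_card
  have hqN : (0 : ℝ) < (Fintype.card F : ℝ) ^ N := by positivity
  have hqmN : (Fintype.card F : ℝ) ^ m ≤ (Fintype.card F : ℝ) ^ N :=
    pow_le_pow_right₀ hq.le hN
  have hEG : 1 - (E.card : ℝ) / G ≤ (Fintype.card F : ℝ) ^ m / (Fintype.card F : ℝ) ^ N := by
    have h1 : (Fintype.card F : ℝ) ^ N * All ≤ (Fintype.card F : ℝ) ^ N * V +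
      (Fintype.card F : ℝ) ^ m * All := by exact_mod_cast hV
    have h2 : (G : ℝ) ≤ All * S := by exact_mod_cast hG
    have h3 : (E.card : ℝ) = V * S := by exact_mod_cast hE
    have h4 : ((Fintype.card F : ℝ) ^ N - (Fintype.card F : ℝ) ^ m) * G ≤
        (Fintype.card F : ℝ) ^ N * E.card := by
      calc _ ≤ ((Fintype.card F : ℝ) ^ N - (Fintype.card F : ℝ) ^ m) * (All * S) :=
            mul_le_mul_of_nonneg_left h2 (sub_nonneg.2 hqmN)
        _ = ((Fintype.card F : ℝ) ^ N * All - (Fintype.card F : ℝ) ^ m * All) * S := by ring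
        _ ≤ ((Fintype.card F : ℝ) ^ N * V) * S :=
            mul_le_mul_of_nonneg_right (by linarith) (Nat.cast_nonneg _)
        _ = _ := by rw [h3]; ring
    rw [sub_le_iff_le_add, ← sub_le_iff_le_add', le_div_iff₀ hG0]
    refine le_of_mul_le_mul_left (le_of_eq_of_le ?_ h4) hqN
    field_simp
  refine le_trans ?_ hEG
  set I := (E.filter fun M => charCoeffs d₁ d₂ M ∈ A).card
  have hI : (I : ℝ) / G = A.card / W * (E.card / G) := by
    have : (W : ℝ) * I = A.card * E.card := by exact_mod_cast hEA
    field_simp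
    linarith
  have hα0 : (0 : ℝ) ≤ A.card / W := by positivity
  have hα1 : (A.card : ℝ) / W ≤ 1 := (div_le_one hW0).2 (by exact_mod_cast hW)
  have he1 : (E.card : ℝ) / G ≤ 1 := (div_le_one hG0).2 (by exact_mod_cast Finset.card_le_univ E)
  have hT1' : (I : ℝ) / G ≤ T.card / G := by gcongr
  have hT2' : (T.card : ℝ) / G + E.card / G ≤ I / G + 1 := by
    rw [← div_self hG0.ne', ← add_div, ← add_div]
    refine div_le_div_of_nonneg_right ?_ hG0.le
    exact_mod_cast hT2
  rw [hI] at hT1' hT2'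
  rw [abs_le]
  constructor <;> nlinarith

end Counting

section Reduction

open Matrix

@[to_additive toReal_measure_preimage_eq_card_div_of_addGroup]
theorem toReal_measure_preimage_eq_card_div {G H : Type*} [Group G] [MeasurableSpace G]
    [MeasurableMul G] (μ : Measure G) [μ.IsMulLeftInvariant] [IsProbabilityMeasure μ] [Group H]
    [Fintype H] (π : G →* H) (hπ : Function.Surjective π) (hm : MeasurableSet (π ⁻¹' {1}))
    (s : Finset H) : (μ (π ⁻¹' s)).toReal = s.card / Fintype.card H := by
  have h1 : ∀ h : H, ∃ g : G, π ⁻¹' {h} = (fun x => g * x) ⁻¹' (π ⁻¹' {1}) := by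
    intro h
    obtain ⟨g, rfl⟩ := hπ h
    refine ⟨g⁻¹, ?_⟩
    ext x
    simp only [Set.mem_preimage, Set.mem_singleton_iff, map_mul, map_inv, inv_mul_eq_one]
    exact eq_comm
  have hmeas : ∀ h : H, MeasurableSet (π ⁻¹' {h}) := by
    intro h
    obtain ⟨g, hg⟩ := h1 h
    rw [hg]
    exact measurable_const_mul g hm
  have hμ : ∀ h : H, μ (π ⁻¹' {h}) = μ (π ⁻¹' {1}) := by
    intro h
    obtain ⟨g, hg⟩ := h1 h
    rw [hg, measure_preimage_mul]
  have key : ∀ s : Finset H, μ (π ⁻¹' s) = s.card * μ (π ⁻¹' {1}) := by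
    intro s
    have h2 : π ⁻¹' (s : Set H) = ⋃ h ∈ s, π ⁻¹' {h} := by
      ext x
      simp
    rw [h2, measure_biUnion_finset _ fun h _ => hmeas h, Finset.sum_congr rfl fun h _ => hμ h,
      Finset.sum_const, nsmul_eq_mul]
    intro h _ h' _ hne
    exact Disjoint.preimage _ (Set.disjoint_singleton.2 hne)
  have h3 := key Finset.univ
  rw [Finset.coe_univ, Set.preimage_univ, measure_univ, Finset.card_univ] at h3
  have h4 := congrArg ENNReal.toReal h3
  rw [ENNReal.toReal_one, ENNReal.toReal_mul, ENNReal.toReal_natCast] at h4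
  have h5 : (Fintype.card H : ℝ) ≠ 0 := Nat.cast_ne_zero.2 Fintype.card_ne_zero
  rw [key, ENNReal.toReal_mul, ENNReal.toReal_natCast, eq_div_iff h5, mul_assoc,
    mul_comm (ENNReal.toReal _), ← h4, mul_one]

variable {p : ℕ} [hp : Fact p.Prime]

theorem PadicInt.toZModPow_surjective (k : ℕ) :
    Function.Surjective (PadicInt.toZModPow k : ℤ_[p] →+* ZMod (p ^ k)) := fun x => by
  obtain ⟨z, rfl⟩ := ZMod.intCast_surjective x
  exact ⟨z, map_intCast _ z⟩

theorem PadicInt.isOpen_preimage_toZModPow (k : ℕ) (x : ZMod (p ^ k)) :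
    IsOpen ((PadicInt.toZModPow k : ℤ_[p] →+* ZMod (p ^ k)) ⁻¹' {x}) := by
  obtain ⟨c, rfl⟩ := PadicInt.toZModPow_surjective k x
  have : (PadicInt.toZModPow k : ℤ_[p] →+* ZMod (p ^ k)) ⁻¹' {PadicInt.toZModPow k c} =
      Metric.closedBall c ((p : ℝ) ^ (-(k : ℤ))) := by
    ext y
    rw [Set.mem_preimage, Set.mem_singleton_iff, mem_closedBall_iff_norm,
      PadicInt.norm_le_pow_iff_mem_span_pow, ← PadicInt.ker_toZModPow, RingHom.sub_mem_ker_iff]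
  rw [this]
  refine IsUltrametricDist.isOpen_closedBall c (ne_of_gt ?_)
  have := hp.out.pos
  positivity

theorem PadicInt.norm_le_pow_iff_dvd_toZModPow {k r : ℕ} (hr : r ≤ k) (x : ℤ_[p]) :
    ‖x‖ ≤ (p : ℝ) ^ (-(r : ℤ)) ↔ (p : ZMod (p ^ k)) ^ r ∣ PadicInt.toZModPow k x := by
  rw [PadicInt.norm_le_pow_iff_mem_span_pow, Ideal.mem_span_singleton]
  constructor
  · rintro ⟨y, rfl⟩
    exact ⟨PadicInt.toZModPow k y, by simp⟩
  · rintro ⟨y, hy⟩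
    obtain ⟨z, rfl⟩ := PadicInt.toZModPow_surjective k y
    have h1 : x - p ^ r * z ∈ RingHom.ker (PadicInt.toZModPow k : ℤ_[p] →+* ZMod (p ^ k)) := by
      rw [RingHom.sub_mem_ker_iff, hy]
      simp
    rw [PadicInt.ker_toZModPow, Ideal.mem_span_singleton] at h1
    exact (dvd_sub_left (dvd_mul_right _ _)).1 ((pow_dvd_pow _ hr).trans h1)

theorem ZMod.prime_dvd_pow_sub {k : ℕ} (z : ZMod (p ^ k)) :
    (p : ZMod (p ^ k)) ∣ z ^ p - z := by
  obtain ⟨a, rfl⟩ := ZMod.intCast_surjective z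
  have h : (p : ℤ) ∣ a ^ p - a := by
    rw [← ZMod.intCast_zmod_eq_zero_iff_dvd]
    simp
  obtain ⟨b, hb⟩ := h
  exact ⟨b, by exact_mod_cast congrArg (Int.cast (R := ZMod (p ^ k))) hb⟩

theorem Units.map_mapMatrix_surjective {R S : Type*} [CommRing R] [CommRing S] (ρ : R →+* S)
    [IsLocalHom ρ] (hρ : Function.Surjective ρ) (n : ℕ) :
    Function.Surjective (Units.map (ρ.mapMatrix (m := Fin n)).toMonoidHom) := by
  intro g
  choose σ hσ using hρ
  have h1 : ρ.mapMatrix (g.1.map σ) = g.1 := by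
    ext i j
    simp [hσ]
  have h2 : IsUnit (g.1.map σ) := by
    rw [isUnit_iff_isUnit_det]
    refine (isUnit_map_iff ρ _).1 ?_
    rw [RingHom.map_det, h1]
    exact (isUnit_iff_isUnit_det _).1 g.isUnit
  obtain ⟨u, hu⟩ := h2
  refine ⟨u, Units.ext ?_⟩
  rw [← h1, ← hu]
  rfl

theorem isOpen_preimage_one_units_map_toZModPow (k n : ℕ) :
    IsOpen ((Units.map ((PadicInt.toZModPow k : ℤ_[p] →+* ZMod (p ^ k)).mapMatrix
      (m := Fin n)).toMonoidHom) ⁻¹' {1}) := by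
  have h : (Units.map ((PadicInt.toZModPow k : ℤ_[p] →+* ZMod (p ^ k)).mapMatrix
      (m := Fin n)).toMonoidHom) ⁻¹' {1} = ⋂ i, ⋂ j,
        (fun M : (Matrix (Fin n) (Fin n) ℤ_[p])ˣ => M.1 i j) ⁻¹'
          ((PadicInt.toZModPow k : ℤ_[p] →+* ZMod (p ^ k)) ⁻¹'
            {(1 : Matrix (Fin n) (Fin n) (ZMod (p ^ k))) i j}) := by
    ext M
    simp only [Set.mem_preimage, Set.mem_singleton_iff, Set.mem_iInter, Units.ext_iff,
      ← Matrix.ext_iff]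
    rfl
  rw [h]
  refine isOpen_iInter_of_finite fun i => isOpen_iInter_of_finite fun j => ?_
  exact (PadicInt.isOpen_preimage_toZModPow k _).preimage
    (Units.continuous_val.matrix_elem i j)

theorem map_trace_pow_sub {R S : Type*} [CommRing R] [CommRing S] (ρ : R →+* S) (p : ℕ) {n d : ℕ}
    (T : (Fin d → S) → Fin d → S)
    (hT : ∀ f F : PowerSeries S, IsNegLogDeriv f F → PowerSeries.coeff 0 f = 1 → ∀ i : Fin d,
        PowerSeries.coeff (i + 1 : ℕ) F -
            (if p ∣ i + 1 then PowerSeries.coeff ((i + 1) / p : ℕ) F else 0) =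
          (p : S) ^ padicValNat p (i + 1) * T (fun j => PowerSeries.coeff (j + 1 : ℕ) f) i)
    (M : (Matrix (Fin n) (Fin n) R)ˣ) (i : Fin d) :
    ρ ((M ^ (i + 1 : ℕ)).1.trace - if p ∣ i + 1 then (M ^ ((i + 1) / p : ℕ)).1.trace else 0) =
      (p : S) ^ padicValNat p (i + 1) *
        T (fun j => (Units.map (ρ.mapMatrix (m := Fin n)).toMonoidHom M).1.charpolyRev.coeff
          (j + 1)) i := by
  set M' := Units.map (ρ.mapMatrix (m := Fin n)).toMonoidHom M with hM'
  have htr : ∀ a : ℕ, ρ (M ^ a).1.trace = (M'.1 ^ a).trace := by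
    intro a
    rw [AddMonoidHom.map_trace, ← Units.val_pow_eq_pow_val, hM', ← map_pow]
    rfl
  have h := hT _ _ (isNegLogDeriv_charpolyRev M'.1) (by simp [Polynomial.coeff_zero_eq_eval_zero]) i
  simp only [PowerSeries.coeff_mk, Nat.succ_ne_zero, if_false, Polynomial.coeff_coe] at h
  rw [← h, map_sub, htr]
  congr 1
  split_ifs with h1 h2
  · have : 0 < ((i : ℕ) + 1) / p :=
      Nat.div_pos (Nat.le_of_dvd (Nat.succ_pos _) h1) (Nat.pos_of_dvd_of_pos h1 (Nat.succ_pos _))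
    exact absurd h2 this.ne'
  · exact htr _
  · exact map_zero ρ

end Reduction

theorem prod_Icc_erase_zero {β : Type*} [CommMonoid β] (f : ℤ → β) (d₁ d₂ : ℕ) :
    ∏ i ∈ (Finset.Icc (-(d₂ : ℤ)) (d₁ : ℤ)).erase 0, f i =
      (∏ j : Fin d₁, f ((j + 1 : ℕ) : ℤ)) * ∏ j : Fin d₂, f (-((j + 1 : ℕ) : ℤ)) := by
  rw [← Fintype.prod_sumElim]
  symm
  refine Finset.prod_bij (fun s _ => Sum.elim (fun j : Fin d₁ => ((j + 1 : ℕ) : ℤ))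
    (fun j : Fin d₂ => -((j + 1 : ℕ) : ℤ)) s) ?_ ?_ ?_ ?_
  · rintro (j | j) _ <;> simp only [Sum.elim_inl, Sum.elim_inr, Finset.mem_erase, Finset.mem_Icc] <;>
      omega
  · rintro (j | j) _ (l | l) _ h <;> simp only [Sum.elim_inl, Sum.elim_inr] at h
    · exact congrArg Sum.inl (Fin.ext (by omega))
    · omega
    · omega
    · exact congrArg Sum.inr (Fin.ext (by omega))
  · intro i hi
    rw [Finset.mem_erase, Finset.mem_Icc] at hi
    rcases lt_or_gt_of_ne hi.1 with h | h
    · exact ⟨Sum.inr ⟨i.natAbs - 1, by omega⟩, Finset.mem_univ _, by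
        simp only [Sum.elim_inr]; omega⟩
    · exact ⟨Sum.inl ⟨i.natAbs - 1, by omega⟩, Finset.mem_univ _, by
        simp only [Sum.elim_inl]; omega⟩
  · rintro (j | j) _ <;> rfl

theorem forall_ne_zero_iff_forall_fin (P : ℤ → Prop) (d₁ d₂ : ℕ) :
    (∀ i : ℤ, i ≠ 0 → -(d₂ : ℤ) ≤ i → i ≤ (d₁ : ℤ) → P i) ↔
      (∀ j : Fin d₁, P ((j + 1 : ℕ) : ℤ)) ∧ ∀ j : Fin d₂, P (-((j + 1 : ℕ) : ℤ)) := by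
  constructor
  · exact fun h => ⟨fun j => h _ (by omega) (by omega) (by omega),
      fun j => h _ (by omega) (by omega) (by omega)⟩
  · rintro ⟨h₁, h₂⟩ i hi hi₂ hi₁
    rcases lt_or_gt_of_ne hi with h | h
    · have := h₂ ⟨i.natAbs - 1, by omega⟩
      rwa [show -(((i.natAbs - 1 + 1 : ℕ)) : ℤ) = i by omega] at this
    · have := h₁ ⟨i.natAbs - 1, by omega⟩
      rwa [show (((i.natAbs - 1 + 1 : ℕ)) : ℤ) = i by omega] at this

section Trace

variable {R : Type*} [CommRing R] {n : ℕ}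

theorem trace_zpow_natCast_sub (p : ℕ) (M : (Matrix (Fin n) (Fin n) R)ˣ) (a : ℕ) :
    ((M ^ (a : ℤ)).1.trace - if (p : ℤ) ∣ a then (M ^ ((a : ℤ) / p)).1.trace else 0) =
      (M ^ a).1.trace - if p ∣ a then (M ^ (a / p)).1.trace else 0 := by
  rw [zpow_natCast]
  congr 1
  refine if_congr Int.natCast_dvd_natCast ?_ rfl
  rw [← Int.natCast_div, zpow_natCast]

theorem trace_zpow_neg_natCast_sub (p : ℕ) (M : (Matrix (Fin n) (Fin n) R)ˣ) (a : ℕ) :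
    ((M ^ (-(a : ℤ))).1.trace - if (p : ℤ) ∣ -a then (M ^ (-(a : ℤ) / p)).1.trace else 0) =
      (M⁻¹ ^ a).1.trace - if p ∣ a then (M⁻¹ ^ (a / p)).1.trace else 0 := by
  rw [zpow_neg, zpow_natCast, ← inv_pow]
  congr 1
  by_cases h : p ∣ a
  · have h' : (p : ℤ) ∣ a := Int.natCast_dvd_natCast.2 h
    rw [if_pos h, if_pos ((dvd_neg).2 h'), Int.neg_ediv_of_dvd h', zpow_neg, ← Int.natCast_div,
      zpow_natCast, inv_pow]
  · rw [if_neg h, if_neg fun h' => h (Int.natCast_dvd_natCast.1 ((dvd_neg).1 h'))]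

end Trace

/-- Diaconis–Shahshahani analog for `GL_n(ℤ_p)`, `p` an odd prime: fixing closed balls
`B_i ⊆ ℤ_p` (center `c i`, radius `p^{-r i}`) for the nonzero `i` with `−d₂ ≤ i ≤ d₁`,
the Haar-probability of the set of `M ∈ GL_n(ℤ_p)` such that
`tr(M^i) − [p ∣ i]·tr(M^{i/p}) ∈ B_i` for all such `i` converges, as `n → ∞`, to the
product over these `i` of `ν {x : p^{v_p(i)}·x ∈ B_i}`, where `ν` is the Haar probability
measure on `ℤ_p`. -/
theorem stmt_19 (p : ℕ) [Fact p.Prime] (hp : Odd p) (d₁ d₂ : ℕ)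
    (c : ℤ → ℤ_[p]) (r : ℤ → ℕ)
    (μ : ∀ n : ℕ, Measure (Matrix (Fin n) (Fin n) ℤ_[p])ˣ)
    (hμHaar : ∀ n, (μ n).IsHaarMeasure)
    (hμProb : ∀ n, IsProbabilityMeasure (μ n))
    (ν : Measure ℤ_[p]) (hνHaar : ν.IsAddHaarMeasure) (hνProb : IsProbabilityMeasure ν) :
    Tendsto (fun n : ℕ =>
        (μ n {M : (Matrix (Fin n) (Fin n) ℤ_[p])ˣ |
            ∀ i : ℤ, i ≠ 0 → -(d₂ : ℤ) ≤ i → i ≤ (d₁ : ℤ) →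
              ‖Matrix.trace ((M ^ i : (Matrix (Fin n) (Fin n) ℤ_[p])ˣ) :
                    Matrix (Fin n) (Fin n) ℤ_[p]) -
                  (if (p : ℤ) ∣ i then
                      Matrix.trace ((M ^ (i / (p : ℤ)) : (Matrix (Fin n) (Fin n) ℤ_[p])ˣ) :
                        Matrix (Fin n) (Fin n) ℤ_[p])
                    else 0) - c i‖ ≤ (p : ℝ) ^ (-(r i : ℤ))}).toReal)
      atTop
      (nhds (∏ i ∈ (Finset.Icc (-(d₂ : ℤ)) (d₁ : ℤ)).erase 0,
        (ν {x : ℤ_[p] |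
          ‖(p : ℤ_[p]) ^ padicValInt p i * x - c i‖ ≤ (p : ℝ) ^ (-(r i : ℤ))}).toReal)) := by
  classical
  have hprime : p.Prime := Fact.out
  obtain ⟨k, hk0, hk⟩ : ∃ k : ℕ, k ≠ 0 ∧ ∀ i ∈ Finset.Icc (-(d₂ : ℤ)) (d₁ : ℤ), r i ≤ k :=
    ⟨1 + ∑ i ∈ Finset.Icc (-(d₂ : ℤ)) (d₁ : ℤ), r i, by omega, fun i hi =>
      (Finset.single_le_sum (fun _ _ => Nat.zero_le _) hi).trans (Nat.le_add_left _ _)⟩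
  have hr₁ : ∀ j : Fin d₁, r ((j + 1 : ℕ) : ℤ) ≤ k := fun j =>
    hk _ (Finset.mem_Icc.2 ⟨by omega, by omega⟩)
  have hr₂ : ∀ j : Fin d₂, r (-((j + 1 : ℕ) : ℤ)) ≤ k := fun j =>
    hk _ (Finset.mem_Icc.2 ⟨by omega, by omega⟩)
  have : NeZero (p ^ k) := ⟨pow_ne_zero k hprime.ne_zero⟩
  have : Fact (1 < p ^ k) := ⟨Nat.one_lt_pow hk0 hprime.one_lt⟩
  let ρ : ℤ_[p] →+* ZMod (p ^ k) := PadicInt.toZModPow k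
  have hρ : Function.Surjective ρ := PadicInt.toZModPow_surjective k
  have : IsLocalRing (ZMod (p ^ k)) := IsLocalRing.of_surjective' ρ hρ
  have : IsLocalHom ρ := IsLocalHom.of_surjective ρ hρ
  have hU : ∀ m : ℕ, ¬ p ∣ m → IsUnit (m : ZMod (p ^ k)) := fun m hm =>
    (ZMod.isUnit_natCast_iff_not_dvd_pow hprime (Nat.pos_of_ne_zero hk0)).2 hm
  obtain ⟨T₁, hT₁, hT₁'⟩ := exists_bijective_ghost p (ZMod.prime_dvd_pow_sub (k := k)) hU d₁
  obtain ⟨T₂, hT₂, hT₂'⟩ := exists_bijective_ghost p (ZMod.prime_dvd_pow_sub (k := k)) hU d₂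
  let B : ℤ → Finset (ZMod (p ^ k)) := fun i => Finset.univ.filter fun z =>
    (p : ZMod (p ^ k)) ^ r i ∣ (p : ZMod (p ^ k)) ^ padicValInt p i * z - ρ (c i)
  let A : Finset ((Fin d₁ → ZMod (p ^ k)) × (Fin d₂ → ZMod (p ^ k))) := Finset.univ.filter fun w =>
    (∀ j : Fin d₁, T₁ w.1 j ∈ B ((j + 1 : ℕ) : ℤ)) ∧ ∀ j : Fin d₂, T₂ w.2 j ∈ B (-((j + 1 : ℕ) : ℤ))
  have hA : A.card = (∏ j : Fin d₁, (B ((j + 1 : ℕ) : ℤ)).card) *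
      ∏ j : Fin d₂, (B (-((j + 1 : ℕ) : ℤ))).card := by
    rw [← Fintype.card_piFinset, ← Fintype.card_piFinset, ← Finset.card_product]
    refine Finset.card_equiv (Equiv.prodCongr (Equiv.ofBijective T₁ hT₁) (Equiv.ofBijective T₂ hT₂))
      fun w => ?_
    simp [A, Fintype.mem_piFinset]
  have hν : ∀ i : ℤ, r i ≤ k → (ν {x : ℤ_[p] |
      ‖(p : ℤ_[p]) ^ padicValInt p i * x - c i‖ ≤ (p : ℝ) ^ (-(r i : ℤ))}).toReal =
        (B i).card / Fintype.card (ZMod (p ^ k)) := by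
    intro i hi
    rw [← toReal_measure_preimage_eq_card_div_of_addGroup ν ρ.toAddMonoidHom hρ
      (PadicInt.isOpen_preimage_toZModPow k 0).measurableSet]
    congr 2
    ext x
    rw [Set.mem_ofPred_eq, PadicInt.norm_le_pow_iff_dvd_toZModPow hi]
    simp [B, ρ]
  have hprod : ∏ i ∈ (Finset.Icc (-(d₂ : ℤ)) (d₁ : ℤ)).erase 0, (ν {x : ℤ_[p] |
      ‖(p : ℤ_[p]) ^ padicValInt p i * x - c i‖ ≤ (p : ℝ) ^ (-(r i : ℤ))}).toReal =
      A.card / Fintype.card ((Fin d₁ → ZMod (p ^ k)) × (Fin d₂ → ZMod (p ^ k))) := by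
    rw [prod_Icc_erase_zero, Finset.prod_congr rfl fun j _ => hν _ (hr₁ j),
      Finset.prod_congr rfl fun j _ => hν _ (hr₂ j), hA]
    simp [Finset.prod_div_distrib, mul_div_mul_comm]
  have : Finite (IsLocalRing.ResidueField (ZMod (p ^ k))) :=
    Finite.of_surjective _ IsLocalRing.residue_surjective
  have := Fintype.ofFinite (IsLocalRing.ResidueField (ZMod (p ^ k)))
  set q := Fintype.card (IsLocalRing.ResidueField (ZMod (p ^ k)))
  have hq : (1 : ℝ) < q := by exact_mod_cast Fintype.one_lt_card
  rw [hprod, ← tendsto_add_atTop_iff_nat 1, tendsto_iff_norm_sub_tendsto_zero]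
  refine squeeze_zero' (Eventually.of_forall fun _ => norm_nonneg _) ?_
    (tendsto_const_nhds.div_atTop (tendsto_pow_atTop_atTop_of_one_lt hq) :
      Tendsto (fun N : ℕ => (q : ℝ) ^ (d₁ + d₂) / (q : ℝ) ^ N) atTop (nhds 0))
  filter_upwards [eventually_ge_atTop (d₁ + d₂)] with N hN
  let π : (Matrix (Fin (N + 1)) (Fin (N + 1)) ℤ_[p])ˣ →*
      (Matrix (Fin (N + 1)) (Fin (N + 1)) (ZMod (p ^ k)))ˣ :=
    Units.map (ρ.mapMatrix (m := Fin (N + 1))).toMonoidHom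
  have hset : {M : (Matrix (Fin (N + 1)) (Fin (N + 1)) ℤ_[p])ˣ |
      ∀ i : ℤ, i ≠ 0 → -(d₂ : ℤ) ≤ i → i ≤ (d₁ : ℤ) →
        ‖Matrix.trace ((M ^ i : (Matrix (Fin (N + 1)) (Fin (N + 1)) ℤ_[p])ˣ) :
              Matrix (Fin (N + 1)) (Fin (N + 1)) ℤ_[p]) -
            (if (p : ℤ) ∣ i then
                Matrix.trace ((M ^ (i / (p : ℤ)) : (Matrix (Fin (N + 1)) (Fin (N + 1)) ℤ_[p])ˣ) :
                  Matrix (Fin (N + 1)) (Fin (N + 1)) ℤ_[p])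
              else 0) - c i‖ ≤ (p : ℝ) ^ (-(r i : ℤ))} =
      π ⁻¹' ((Finset.univ.filter fun M : (Matrix (Fin (N + 1)) (Fin (N + 1)) (ZMod (p ^ k)))ˣ =>
        charCoeffs d₁ d₂ M ∈ A : Finset (Matrix (Fin (N + 1)) (Fin (N + 1)) (ZMod (p ^ k)))ˣ) :
          Set (Matrix (Fin (N + 1)) (Fin (N + 1)) (ZMod (p ^ k)))ˣ) := by
    ext M
    rw [Set.mem_ofPred_eq, forall_ne_zero_iff_forall_fin]
    simp only [Set.mem_preimage, Finset.mem_coe, Finset.mem_filter, Finset.mem_univ, true_and, A, B]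
    refine and_congr (forall_congr' fun j => ?_) (forall_congr' fun j => ?_)
    · rw [PadicInt.norm_le_pow_iff_dvd_toZModPow (hr₁ j), trace_zpow_natCast_sub, map_sub,
        map_trace_pow_sub (PadicInt.toZModPow k) p T₁ hT₁', padicValInt.of_nat]
      simp [charCoeffs, π, ρ]
    · rw [PadicInt.norm_le_pow_iff_dvd_toZModPow (hr₂ j), trace_zpow_neg_natCast_sub, map_sub,
        map_trace_pow_sub (PadicInt.toZModPow k) p T₂ hT₂', padicValInt, Int.natAbs_neg,
        Int.natAbs_natCast]
      simp [charCoeffs, π, ρ]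
  rw [hset, Real.norm_eq_abs, toReal_measure_preimage_eq_card_div (μ (N + 1)) π
    (Units.map_mapMatrix_surjective ρ hρ (N + 1))
    (isOpen_preimage_one_units_map_toZModPow k (N + 1)).measurableSet]
  convert abs_card_charCoeffs_sub_le (IsLocalRing.residue (ZMod (p ^ k)))
    IsLocalRing.residue_surjective hN A
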